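/- arXiv:1206.3977 — 3 statements merged into one kernel-verified Lean document; each statement's English description precedes it below -/
import Mathlib

section
/- Let J ⊊ I be square-free monomial ideals of S = K[x_1,...,x_n] with I generated in degrees ≥ d and J generated in degrees ≥ d+1. Let ρ_t(I\J) denote the number of square-free monomials of degree t lying in I but not in J. If ρ_d(I) > ρ_{d+1}(I\J), then depth_S(I/J) = d, independently of the characteristic of K. -/
open MvPolynomial

/-- A squarefree exponent vector. -/
def IsSqfree {n : ℕ} (m : Fin n →₀ ℕ) : Prop := ∀ j, m j ≤ 1

/-- Total degree of an exponent vector. -/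
def mdeg {n : ℕ} (m : Fin n →₀ ℕ) : ℕ := m.sum fun _ e => e

/-- `I` is generated by squarefree monomials of degree `≥ d`. -/
def GenSqfreeGe (K : Type*) [Field K] {n : ℕ} (d : ℕ)
    (I : Ideal (MvPolynomial (Fin n) K)) : Prop :=
  ∃ G : Set (Fin n →₀ ℕ), (∀ m ∈ G, IsSqfree m ∧ d ≤ mdeg m) ∧
    I = Ideal.span ((fun m => monomial m (1 : K)) '' G)

/-- `ρ_t(I \ J)`: the number of squarefree monomials of degree `t` in `I \ J`. -/
noncomputable def rho (K : Type*) [Field K] {n : ℕ}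
    (I J : Ideal (MvPolynomial (Fin n) K)) (t : ℕ) : ℕ :=
  Set.ncard {m : Fin n →₀ ℕ | IsSqfree m ∧ mdeg m = t ∧
    monomial m (1 : K) ∈ I ∧ monomial m (1 : K) ∉ J}

/-- The `S`-module `I/J`. -/
abbrev quotMod {K : Type*} [Field K] {n : ℕ}
    (I J : Ideal (MvPolynomial (Fin n) K)) :=
  I ⧸ (Submodule.comap I.subtype (J : Submodule (MvPolynomial (Fin n) K) (MvPolynomial (Fin n) K)))

/-- Depth of a module over `K[x_1,…,x_n]` w.r.t. the maximal graded ideal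
`(x_1,…,x_n)`: the supremum of lengths of regular sequences on `M` from it. -/
noncomputable def mdepth (K : Type*) [Field K] (n : ℕ)
    (M : Type*) [AddCommGroup M] [Module (MvPolynomial (Fin n) K) M] : ℕ :=
  sSup {k | ∃ rs : List (MvPolynomial (Fin n) K), rs.length = k ∧
    (∀ r ∈ rs, r ∈ Ideal.span (Set.range (X : Fin n → MvPolynomial (Fin n) K))) ∧
    RingTheory.Sequence.IsRegular M rs}

namespace Koszul

open scoped Pointwise

variable {ι R M N : Type*} [LinearOrder ι] [CommRing R] [AddCommGroup M] [Module R M]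
  [AddCommGroup N] [Module R N]

/-- The sign `(-1) ^ #{i ∈ T | i < k}`. -/
def sgn (k : ι) (T : Finset ι) : ℤ := (-1) ^ (T.filter (· < k)).card

theorem sgn_mul_self (k : ι) (T : Finset ι) : sgn k T * sgn k T = 1 := by
  rw [sgn, ← mul_pow]; simp

theorem sgn_insert {j k : ι} {T : Finset ι} (hk : k ∉ T) :
    sgn j (insert k T) = if k < j then -sgn j T else sgn j T := by
  unfold sgn
  rw [Finset.filter_insert]
  split_ifs with h
  · rw [Finset.card_insert_of_notMem (by simp [hk]), pow_succ]; ring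
  · rfl

theorem sgn_erase {j k : ι} {T : Finset ι} (hk : k ∈ T) :
    sgn j (T.erase k) = if k < j then -sgn j T else sgn j T := by
  have := sgn_insert (j := j) (Finset.notMem_erase k T)
  rw [Finset.insert_erase hk] at this
  split_ifs at this ⊢ <;> simp [this]

/-- The differential of the Koszul cochain complex of `x` with coefficients in `M`; a cochain is
a family of elements of `M` indexed by the finite sets of indices. -/
def diff (x : ι → R) : (Finset ι → M) →ₗ[R] (Finset ι → M) :=
  LinearMap.pi fun T => ∑ k ∈ T, sgn k T • x k • LinearMap.proj (T.erase k)

theorem diff_apply (x : ι → R) (z : Finset ι → M) (T : Finset ι) :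
    diff x z T = ∑ k ∈ T, sgn k T • x k • z (T.erase k) := by
  simp [diff]

theorem diff_comp (x : ι → R) (f : M →ₗ[R] N) (z : Finset ι → M) :
    diff x (f ∘ z) = f ∘ diff x z := by
  ext T; simp [diff_apply]

theorem diff_diff (x : ι → R) (z : Finset ι → M) : diff x (diff x z) = 0 := by
  ext T
  simp only [diff_apply, Finset.smul_sum, Pi.zero_apply]
  rw [Finset.sum_sigma']
  refine Finset.sum_involution (fun p _ => ⟨p.2, p.1⟩) ?_ ?_ ?_ ?_
  · rintro ⟨k, l⟩ h
    simp only [Finset.mem_sigma, Finset.mem_erase] at h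
    obtain ⟨hk, hlk, hl⟩ := h
    simp only [sgn_erase hk, sgn_erase hl, Finset.erase_right_comm (a := l) (b := k),
      smul_comm (x _) (_ : ℤ), smul_comm (x l) (x k), smul_smul (_ : ℤ) (_ : ℤ), ← add_smul]
    rcases lt_or_gt_of_ne hlk with h | h
    · simp [h, h.not_gt, mul_comm]
    · simp [h, h.not_gt, mul_comm]
  · rintro ⟨k, l⟩ h _ h'
    simp only [Finset.mem_sigma, Finset.mem_erase] at h
    simp only [Sigma.mk.injEq, heq_eq_eq] at h'
    exact h.2.1 h'.1
  · rintro ⟨k, l⟩ h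
    simp only [Finset.mem_sigma, Finset.mem_erase] at h ⊢
    exact ⟨h.2.2, h.2.1.symm, h.1⟩
  · rintro ⟨k, l⟩ _; rfl

/-- Contraction of a cochain with the `j`-th basis vector, composed with `G`. -/
def contract (G : M →+ M) (j : ι) (z : Finset ι → M) (T : Finset ι) : M :=
  if j ∈ T then 0 else sgn j T • G (z (insert j T))

theorem diff_contract_add_contract_diff (x : ι → R) (G : M →+ M) (j : ι)
    (hG : ∀ k ≠ j, ∀ m, G (x k • m) = x k • G m) (z : Finset ι → M) (T : Finset ι) :
    diff x (contract G j z) T + contract G j (diff x z) T =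
      if j ∈ T then x j • G (z T) else G (x j • z T) := by
  simp only [diff_apply, contract]
  split_ifs with hj
  · rw [add_zero, Finset.sum_eq_single j]
    · simp [sgn_erase hj, Finset.insert_erase hj, smul_comm (x j) (_ : ℤ),
        smul_smul (_ : ℤ) (_ : ℤ), sgn_mul_self]
    · intro k _ hkj
      simp [hj, hkj.symm]
    · simp [hj]
  · rw [Finset.sum_insert hj]
    simp only [map_add, map_sum, map_zsmul, smul_add, Finset.smul_sum, Finset.erase_insert hj,
      smul_smul (_ : ℤ) (_ : ℤ)]
    rw [sgn_insert hj, if_neg (lt_irrefl j), sgn_mul_self, one_smul, add_left_comm,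
      ← Finset.sum_add_distrib, Finset.sum_eq_zero, add_zero]
    intro k hk
    have hkj : k ≠ j := fun h => hj (h ▸ hk)
    rw [if_neg (by simp [hj]), hG k hkj, Finset.erase_insert_of_ne hkj.symm, sgn_insert hj,
      sgn_erase hk, smul_comm (x k) (_ : ℤ), smul_smul (_ : ℤ) (_ : ℤ), ← add_smul]
    rcases lt_or_gt_of_ne hkj with h | h
    · simp [h, h.not_gt, mul_comm]
    · simp [h, h.not_gt, mul_comm]

theorem diff_contract_id (x : ι → R) (j : ι) (z : Finset ι → M) (hz : diff x z = 0) :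
    diff x (contract (AddMonoidHom.id M) j z) = x j • z := by
  ext T
  have := diff_contract_add_contract_diff x (AddMonoidHom.id M) j (by simp) z T
  have h0 : contract (AddMonoidHom.id M) j (diff x z) T = 0 := by simp [hz, contract]
  simpa [h0] using this

/-- Cochains that vanish in cohomological degrees `≥ k`. -/
def VanishGe (k : ℕ) (z : Finset ι → M) : Prop := ∀ T, k ≤ T.card → z T = 0

theorem VanishGe.diff {x : ι → R} {k : ℕ} {z : Finset ι → M} (hz : VanishGe k z) :
    VanishGe (k + 1) (diff x z) := by
  intro T hT
  rw [diff_apply]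
  refine Finset.sum_eq_zero fun i hi => ?_
  rw [hz _ (by rw [Finset.card_erase_of_mem hi]; omega)]; simp

theorem VanishGe.contract {G : M →+ M} {j : ι} {k : ℕ} {z : Finset ι → M}
    (hz : VanishGe (k + 1) z) : VanishGe k (contract G j z) := by
  intro T hT
  unfold Koszul.contract
  split_ifs with hj
  · rfl
  · rw [hz _ (by rw [Finset.card_insert_of_notMem hj]; omega)]; simp

theorem exists_contraction {x : ι → R} {r : R} (hr : r ∈ Ideal.span (Set.range x)) {k : ℕ}
    {z : Finset ι → M} (hz : VanishGe (k + 1) z) (hdz : diff x z = 0) :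
    ∃ w, VanishGe k w ∧ diff x w = r • z := by
  induction hr using Submodule.span_induction with
  | mem r h =>
    obtain ⟨j, rfl⟩ := h
    exact ⟨_, hz.contract, diff_contract_id x j z hdz⟩
  | zero => exact ⟨0, fun _ _ => rfl, by simp⟩
  | add a b _ _ ha hb =>
    obtain ⟨u, hu, hu'⟩ := ha
    obtain ⟨v, hv, hv'⟩ := hb
    exact ⟨u + v, fun T hT => by simp [hu T hT, hv T hT], by rw [map_add, hu', hv', add_smul]⟩
  | smul a b _ hb =>
    obtain ⟨u, hu, hu'⟩ := hb
    exact ⟨a • u, fun T hT => by simp [hu T hT], by rw [map_smul, hu', smul_assoc]⟩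

/-- The Koszul cohomology of `M` vanishes in degrees `< k`. -/
def Acyclic (x : ι → R) (M : Type*) [AddCommGroup M] [Module R M] (k : ℕ) : Prop :=
  ∀ z : Finset ι → M, VanishGe k z → diff x z = 0 → ∃ w, diff x w = z

theorem Acyclic.mono {x : ι → R} {k l : ℕ} (h : Acyclic x M l) (hkl : k ≤ l) : Acyclic x M k :=
  fun z hz => h z fun T hT => hz T (hkl.trans hT)

theorem exists_vanishGe_of_diff_eq {x : ι → R} {k : ℕ} {z w : Finset ι → M}
    (hz : VanishGe (k + 1) z) (h : diff x w = z) : ∃ w', VanishGe k w' ∧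
      (∀ T, w' T = 0 ∨ w' T = w T) ∧ diff x w' = z := by
  refine ⟨fun T => if k ≤ T.card then 0 else w T, fun T hT => by simp [hT],
    fun T => ite_eq_or_eq _ _ _, ?_⟩
  ext T
  rcases le_or_gt (k + 1) T.card with hT | hT
  · rw [hz T hT, VanishGe.diff (k := k) (fun T hT => by simp [hT]) T hT]
  · rw [← h, diff_apply, diff_apply]
    refine Finset.sum_congr rfl fun i hi => ?_
    have : 0 < T.card := Finset.card_pos.2 ⟨i, hi⟩
    rw [if_neg (by rw [Finset.card_erase_of_mem hi]; omega)]

theorem VanishGe.exists_lift {α : Type*} {f : M →ₗ[R] N} (hf : Function.Surjective f) {k : ℕ}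
    {z : Finset α → N} (hz : VanishGe k z) : ∃ z' : Finset α → M, VanishGe k z' ∧ f ∘ z' = z := by
  choose g hg using hf
  refine ⟨fun T => if k ≤ T.card then 0 else g (z T), fun T hT => by simp [hT], ?_⟩
  ext T
  by_cases hT : k ≤ T.card
  · simp [hT, hz T hT]
  · simp [hT, hg]

theorem exists_eq_smul_of_mkQ_eq_zero {α : Type*} (r : R) (z : Finset α → M)
    (h : (Submodule.mkQ (r • (⊤ : Submodule R M))) ∘ z = 0) : ∃ u, z = r • u := by
  have (T : Finset α) : ∃ m, r • m = z T := by
    have := congrFun h T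
    simp only [Function.comp_apply, Pi.zero_apply, Submodule.mkQ_apply,
      Submodule.Quotient.mk_eq_zero] at this
    obtain ⟨m, -, hm⟩ := this
    exact ⟨m, hm⟩
  choose u hu using this
  exact ⟨u, by ext T; simp [hu]⟩

theorem pi_injective {α : Type*} {r : R} (hr : IsSMulRegular M r) {u v : Finset α → M}
    (h : r • u = r • v) : u = v :=
  funext fun T => hr (congrFun h T)

theorem mkQ_comp_smul {α : Type*} (r : R) (z : Finset α → M) :
    (Submodule.mkQ (r • (⊤ : Submodule R M))) ∘ (r • z) = 0 := by
  ext T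
  simp only [Function.comp_apply, Pi.zero_apply, Submodule.mkQ_apply,
    Submodule.Quotient.mk_eq_zero, Pi.smul_apply]
  exact ⟨z T, trivial, rfl⟩

theorem acyclic_of_isWeaklyRegular {x : ι → R} (rs : List R)
    (hmem : ∀ r ∈ rs, r ∈ Ideal.span (Set.range x))
    (hrs : RingTheory.Sequence.IsWeaklyRegular M rs) : Acyclic x M rs.length := by
  induction rs generalizing M with
  | nil => exact fun z hz _ => ⟨0, by ext T; simp [hz T]⟩
  | cons r rs ih =>
    rw [RingTheory.Sequence.isWeaklyRegular_cons_iff] at hrs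
    obtain ⟨hr, hrs⟩ := hrs
    intro z hz hdz
    obtain ⟨w, hw, hdw⟩ := exists_contraction (hmem r (by simp)) hz hdz
    have hq := ih (fun s hs => hmem s (by simp [hs])) hrs
    let q : M →ₗ[R] QuotSMulTop r M := Submodule.mkQ (r • (⊤ : Submodule R M))
    obtain ⟨v, hv⟩ := hq (q ∘ w) (fun T hT => by simp [hw T hT]) (by
      rw [diff_comp, hdw]; exact mkQ_comp_smul r z)
    obtain ⟨v, rfl⟩ := (Submodule.mkQ_surjective (r • (⊤ : Submodule R M))).comp_left v
    obtain ⟨u, hu⟩ := exists_eq_smul_of_mkQ_eq_zero r (w - diff x v) (by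
      change q ∘ (w - diff x v) = 0
      have hv' : q ∘ diff x v = q ∘ w := by rw [← diff_comp]; exact hv
      ext T
      have := congrFun hv' T
      simp only [Function.comp_apply] at this
      simp [this])
    refine ⟨u, pi_injective hr ?_⟩
    rw [← map_smul, ← hu, map_sub, diff_diff, sub_zero, hdw]

theorem acyclic_quotSMulTop {x : ι → R} {r : R} (hr : IsSMulRegular M r) {k : ℕ}
    (h : Acyclic x M (k + 1)) : Acyclic x (QuotSMulTop r M) k := by
  intro z hz hdz
  let q : M →ₗ[R] QuotSMulTop r M := Submodule.mkQ (r • (⊤ : Submodule R M))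
  obtain ⟨z, hz', rfl⟩ := hz.exists_lift (f := q) (Submodule.mkQ_surjective _)
  rw [diff_comp] at hdz
  obtain ⟨y, hy⟩ := exists_eq_smul_of_mkQ_eq_zero r _ hdz
  have hy' : VanishGe (k + 1) y := fun T hT => hr (by
    have := congrFun hy T
    rw [hz'.diff T hT] at this
    simpa using this.symm)
  have hdy : diff x y = 0 := pi_injective hr (by rw [← map_smul, ← hy, diff_diff, smul_zero])
  obtain ⟨w, hdw⟩ := h y hy' hdy
  obtain ⟨w, hw, -, rfl⟩ := exists_vanishGe_of_diff_eq hy' hdw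
  obtain ⟨u, hu⟩ := h (z - r • w)
    (fun T hT => by simp [hz' T (by omega), hw T (by omega)])
    (by rw [map_sub, map_smul, hy, sub_self])
  refine ⟨q ∘ u, ?_⟩
  rw [diff_comp, hu]
  have := mkQ_comp_smul r w
  ext T
  have := congrFun this T
  simp only [Function.comp_apply, Pi.sub_apply, map_sub]
  rw [sub_eq_self]
  exact this

theorem eq_zero_of_acyclic {x : ι → R} {k : ℕ} (h : Acyclic x M (k + 1)) {m : M}
    (hm : ∀ j, x j • m = 0) : m = 0 := by
  obtain ⟨w, hw⟩ := h (fun T => if T = ∅ then m else 0)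
    (fun T hT => if_neg (by rintro rfl; simp at hT)) (by
      ext T
      rw [diff_apply]
      refine Finset.sum_eq_zero fun i _ => ?_
      split_ifs <;> simp [hm])
  simpa [diff_apply] using (congrFun hw ∅).symm

theorem exists_isSMulRegular_of_acyclic [IsNoetherianRing R] [Module.Finite R M] {x : ι → R}
    {k : ℕ} (h : Acyclic x M (k + 1)) : ∃ r ∈ Ideal.span (Set.range x), IsSMulRegular M r := by
  by_contra! hc
  have hfin := associatedPrimes.finite R M
  have hsub : ((Ideal.span (Set.range x) : Ideal R) : Set R) ⊆
      ⋃ p ∈ (hfin.toFinset : Set (Ideal R)), (id p : Ideal R) := by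
    intro r hr
    have := hc r hr
    simp only [Set.Finite.coe_toFinset, id]
    rw [biUnion_associatedPrimes_eq_zero_divisors]
    by_contra h0
    refine this (isSMulRegular_iff_right_eq_zero_of_smul.2 fun m hm => ?_)
    by_contra hm0
    exact h0 ⟨m, hm0, hm⟩
  obtain ⟨p, hp, hle⟩ := (Ideal.subset_union_prime (f := id) ⊥ ⊥
    (fun p hp _ _ => (by simpa using hp : p ∈ associatedPrimes R M).isPrime)).1 hsub
  rw [Set.Finite.mem_toFinset, AssociatedPrimes.mem_iff, isAssociatedPrime_iff] at hp
  obtain ⟨hp, m, hm⟩ := hp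
  have hm0 : m = 0 := eq_zero_of_acyclic h fun j => by
    have : x j ∈ p := hle (Ideal.subset_span ⟨j, rfl⟩)
    rw [hm] at this
    simpa using this
  subst hm0
  exact hp.ne_top (by rw [hm]; simp)

theorem exists_isWeaklyRegular_of_acyclic [IsNoetherianRing R] [Module.Finite R M] {x : ι → R}
    {k : ℕ} (h : Acyclic x M k) : ∃ rs : List R, rs.length = k ∧
      (∀ r ∈ rs, r ∈ Ideal.span (Set.range x)) ∧ RingTheory.Sequence.IsWeaklyRegular M rs := by
  induction k generalizing M with
  | zero => exact ⟨[], rfl, by simp, .nil R M⟩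
  | succ k ih =>
    obtain ⟨r, hr, hreg⟩ := exists_isSMulRegular_of_acyclic h
    obtain ⟨rs, hlen, hmem, hrs⟩ := ih (acyclic_quotSMulTop hreg h)
    exact ⟨r :: rs, by simp [hlen], by simpa [hr] using hmem,
      (RingTheory.Sequence.isWeaklyRegular_cons_iff _ _ _).2 ⟨hreg, hrs⟩⟩

end Koszul

section SquarefreeMonomialIdeal

open Koszul

variable {K : Type*} [Field K] {n d : ℕ} {I J : Ideal (MvPolynomial (Fin n) K)}

theorem IsSqfree.mdeg_eq {m : Fin n →₀ ℕ} (hm : IsSqfree m) : mdeg m = m.support.card := by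
  rw [mdeg, Finsupp.sum, Finset.card_eq_sum_ones]
  refine Finset.sum_congr rfl fun j hj => ?_
  have := hm j
  have := Finsupp.mem_support_iff.1 hj
  omega

theorem monomial_mem_span_iff {G : Set (Fin n →₀ ℕ)} {a : Fin n →₀ ℕ} :
    monomial a (1 : K) ∈ Ideal.span ((fun m => monomial m (1 : K)) '' G) ↔ ∃ g ∈ G, g ≤ a := by
  classical
  rw [mem_ideal_span_monomial_image]
  simp [support_monomial]

theorem GenSqfreeGe.mem_iff (hI : GenSqfreeGe K d I) {p : MvPolynomial (Fin n) K} :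
    p ∈ I ↔ ∀ a, coeff a p ≠ 0 → monomial a (1 : K) ∈ I := by
  obtain ⟨G, -, rfl⟩ := hI
  simp [mem_ideal_span_monomial_image]

theorem GenSqfreeGe.monomial_mem_of_support_subset (hI : GenSqfreeGe K d I) {a b : Fin n →₀ ℕ}
    (ha : monomial a (1 : K) ∈ I) (h : a.support ⊆ b.support) : monomial b (1 : K) ∈ I := by
  obtain ⟨G, hG, rfl⟩ := hI
  rw [monomial_mem_span_iff] at ha ⊢
  obtain ⟨g, hg, hga⟩ := ha
  refine ⟨g, hg, fun j => ?_⟩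
  have h1 := (hG g hg).1 j
  have h2 := hga j
  by_cases hj : j ∈ a.support
  · have := Finsupp.mem_support_iff.1 (h hj)
    omega
  · have := Finsupp.notMem_support_iff.1 hj
    omega

theorem GenSqfreeGe.le_card_support (hI : GenSqfreeGe K d I) {a : Fin n →₀ ℕ}
    (ha : monomial a (1 : K) ∈ I) : d ≤ a.support.card := by
  obtain ⟨G, hG, rfl⟩ := hI
  rw [monomial_mem_span_iff] at ha
  obtain ⟨g, hg, hga⟩ := ha
  have := (hG g hg).2
  rw [(hG g hg).1.mdeg_eq] at this
  exact this.trans (Finset.card_le_card (Finsupp.support_mono hga))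

theorem GenSqfreeGe.coeff_eq_zero (hI : GenSqfreeGe K d I) {p : MvPolynomial (Fin n) K}
    (hp : p ∈ I) {a : Fin n →₀ ℕ} (ha : a.support.card < d) : coeff a p = 0 := by
  by_contra h
  have := hI.le_card_support (hI.mem_iff.1 hp a h)
  omega

/-- The additive map dividing by `X j` the monomials divisible by `X j ^ 2` and annihilating the
other monomials. -/
noncomputable def divXSq (j : Fin n) : MvPolynomial (Fin n) K →+ MvPolynomial (Fin n) K where
  toFun p := X j * p.divMonomial (Finsupp.single j 2)
  map_zero' := by simp
  map_add' p q := by rw [add_divMonomial, mul_add]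

theorem coeff_divXSq (j : Fin n) (p : MvPolynomial (Fin n) K) (a : Fin n →₀ ℕ) :
    coeff a (divXSq j p) = if a j = 0 then 0 else coeff (a + Finsupp.single j 1) p := by
  change coeff a (X j * p.divMonomial (Finsupp.single j 2)) = _
  rw [coeff_X_mul', coeff_divMonomial]
  by_cases h : a j = 0
  · simp [h]
  · rw [if_pos (by simpa using h), if_neg h]
    congr 1
    ext i
    by_cases hi : i = j
    · subst hi; simp; omega
    · simp [Ne.symm hi]

theorem coeff_X_mul_ite (j : Fin n) (p : MvPolynomial (Fin n) K) (a : Fin n →₀ ℕ) :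
    coeff a (X j * p) = if a j = 0 then 0 else coeff (a - Finsupp.single j 1) p := by
  rw [coeff_X_mul']
  by_cases h : a j = 0 <;> simp [h]

theorem divXSq_X_mul_of_ne {j k : Fin n} (hkj : k ≠ j) (p : MvPolynomial (Fin n) K) :
    divXSq j (X k * p) = X k * divXSq j p := by
  ext a
  simp only [coeff_divXSq, coeff_X_mul_ite]
  have h1 : (a + Finsupp.single j 1 : Fin n →₀ ℕ) k = a k := by simp [hkj.symm]
  have h2 : (a - Finsupp.single k 1 : Fin n →₀ ℕ) j = a j := by simp [hkj]
  rw [h1, h2]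
  split_ifs
  · rfl
  · rfl
  · rfl
  · congr 1
    ext i
    simp only [Finsupp.coe_add, Finsupp.coe_tsub, Pi.add_apply, Pi.sub_apply, Finsupp.single_apply]
    split_ifs <;> omega

theorem coeff_divXSq_X_mul (j : Fin n) (p : MvPolynomial (Fin n) K) (a : Fin n →₀ ℕ) :
    coeff a (divXSq j (X j * p)) = if a j = 0 then 0 else coeff a p := by
  simp [coeff_divXSq, coeff_X_mul_ite]

theorem coeff_X_mul_divXSq (j : Fin n) (p : MvPolynomial (Fin n) K) (a : Fin n →₀ ℕ) :
    coeff a (X j * divXSq j p) = if a j ≤ 1 then 0 else coeff a p := by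
  rw [coeff_X_mul_ite, coeff_divXSq]
  by_cases h0 : a j = 0
  · simp [h0]
  rw [if_neg h0]
  have : a - Finsupp.single j 1 + Finsupp.single j 1 = a :=
    tsub_add_cancel_of_le (Finsupp.single_le_iff.2 (by omega))
  rw [this]
  refine if_congr ?_ rfl rfl
  simp; omega

theorem GenSqfreeGe.divXSq_mem (hI : GenSqfreeGe K d I) (j : Fin n) {p : MvPolynomial (Fin n) K}
    (hp : p ∈ I) : divXSq j p ∈ I := by
  refine hI.mem_iff.2 fun a ha => ?_
  rw [coeff_divXSq] at ha
  split_ifs at ha with h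
  · exact absurd rfl ha
  · refine hI.monomial_mem_of_support_subset (hI.mem_iff.1 hp _ ha) fun i hi => ?_
    by_cases hij : i = j
    · subst hij; simpa using h
    · simpa [Finsupp.single_apply, Ne.symm hij] using hi

theorem GenSqfreeGe.exists_reduce (hI : GenSqfreeGe K d I)
    (z : Finset (Fin n) → MvPolynomial (Fin n) K) (hz : ∀ T, z T ∈ I)
    (hdz : diff (X : Fin n → MvPolynomial (Fin n) K) z = 0) (s : Finset (Fin n)) :
    ∃ w : Finset (Fin n) → MvPolynomial (Fin n) K, (∀ T, w T ∈ I) ∧ ∀ T a,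
      coeff a ((z - diff (X : Fin n → MvPolynomial (Fin n) K) w) T) =
        if ∀ j ∈ s, a j ≤ if j ∈ T then 1 else 0 then coeff a (z T) else 0 := by
  induction s using Finset.induction_on with
  | empty => exact ⟨0, fun _ => I.zero_mem, by simp⟩
  | insert j s _ ih =>
    obtain ⟨w, hw, hwz⟩ := ih
    set z' := z - diff (X : Fin n → MvPolynomial (Fin n) K) w with hz'
    have hdz' : diff (X : Fin n → MvPolynomial (Fin n) K) z' = 0 := by
      rw [hz', map_sub, hdz, diff_diff, sub_zero]
    have hz'I (T) : z' T ∈ I := hI.mem_iff.2 fun a ha => by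
      rw [hwz] at ha
      split_ifs at ha
      · exact hI.mem_iff.1 (hz T) a ha
      · exact absurd rfl ha
    refine ⟨w + contract (divXSq j) j z', fun T => I.add_mem (hw T) ?_, fun T a => ?_⟩
    · unfold contract
      split_ifs
      · exact I.zero_mem
      · exact zsmul_mem (hI.divXSq_mem j (hz'I _)) _
    · have key := diff_contract_add_contract_diff (X : Fin n → MvPolynomial (Fin n) K) (divXSq j) j
        (fun k hk m => by rw [smul_eq_mul, smul_eq_mul, divXSq_X_mul_of_ne hk]) z' T
      have h0 : contract (divXSq j) j (diff (X : Fin n → MvPolynomial (Fin n) K) z') T = 0 := by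
        simp [hdz', contract]
      rw [h0, add_zero] at key
      rw [map_add, ← sub_sub, ← hz', Pi.sub_apply, key, coeff_sub]
      simp only [Finset.forall_mem_insert, ite_and, ← hwz, smul_eq_mul]
      by_cases hj : j ∈ T
      · simp only [hj, if_true, coeff_X_mul_divXSq]
        split_ifs <;> simp
      · simp only [hj, if_false, coeff_divXSq_X_mul, Nat.le_zero]
        split_ifs <;> simp

theorem GenSqfreeGe.exists_diff_eq (hI : GenSqfreeGe K d I)
    (z : Finset (Fin n) → MvPolynomial (Fin n) K) (hz : ∀ T, z T ∈ I) (hzd : VanishGe d z)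
    (hdz : diff (X : Fin n → MvPolynomial (Fin n) K) z = 0) :
    ∃ w : Finset (Fin n) → MvPolynomial (Fin n) K, (∀ T, w T ∈ I) ∧
      diff (X : Fin n → MvPolynomial (Fin n) K) w = z := by
  obtain ⟨w, hw, hwz⟩ := hI.exists_reduce z hz hdz Finset.univ
  refine ⟨w, hw, (sub_eq_zero.1 (_root_.funext fun T => ?_)).symm⟩
  ext a
  rw [hwz, Pi.zero_apply, coeff_zero]
  split_ifs with h
  · by_contra hne
    have hle := hI.le_card_support (hI.mem_iff.1 (hz T) a hne)
    have hsub : a.support ⊆ T := fun j hj => by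
      by_contra hjT
      have := h j (Finset.mem_univ j)
      rw [if_neg hjT] at this
      exact Finsupp.mem_support_iff.1 hj (by omega)
    exact hne (by rw [hzd T (hle.trans (Finset.card_le_card hsub)), coeff_zero])
  · rfl

/-- The class in `I/J` of an element of `I`. -/
noncomputable abbrev quotMk (I J : Ideal (MvPolynomial (Fin n) K)) :
    I →ₗ[MvPolynomial (Fin n) K] quotMod I J :=
  Submodule.mkQ _

theorem quotMk_eq_zero {p : I} : quotMk I J p = 0 ↔ (p : MvPolynomial (Fin n) K) ∈ J := by
  simp [quotMk]

theorem acyclic_quotMod (hJI : J ≤ I) (hI : GenSqfreeGe K d I) (hJ : GenSqfreeGe K (d + 1) J) :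
    Acyclic (X : Fin n → MvPolynomial (Fin n) K) (quotMod I J) d := by
  intro z hz hdz
  obtain ⟨z, hz', rfl⟩ := hz.exists_lift (f := quotMk I J) (Submodule.mkQ_surjective _)
  rw [diff_comp] at hdz
  let u : Finset (Fin n) → MvPolynomial (Fin n) K := I.subtype ∘ z
  have hu : VanishGe d u := fun T hT => by simp [u, hz' T hT]
  have hduJ (T) : diff (X : Fin n → MvPolynomial (Fin n) K) u T ∈ J := by
    have := congrFun hdz T
    simp only [Function.comp_apply, Pi.zero_apply, quotMk_eq_zero] at this
    rw [diff_comp]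
    exact this
  obtain ⟨w, hwJ, hw⟩ := hJ.exists_diff_eq (diff (X : Fin n → MvPolynomial (Fin n) K) u) hduJ
    hu.diff (diff_diff _ _)
  obtain ⟨w', hw'd, hw'w, hw'⟩ := exists_vanishGe_of_diff_eq hu.diff hw
  have hwJ' (T) : w' T ∈ J := by
    rcases hw'w T with h | h <;> rw [h]
    · exact J.zero_mem
    · exact hwJ T
  obtain ⟨v, hvI, hv⟩ := hI.exists_diff_eq (u - w')
    (fun T => I.sub_mem (z T).2 (hJI (hwJ' T))) (fun T hT => by simp [hu T hT, hw'd T hT])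
    (by rw [map_sub, hw', sub_self])
  refine ⟨quotMk I J ∘ fun T => ⟨v T, hvI T⟩, ?_⟩
  rw [diff_comp]
  ext T
  simp only [Function.comp_apply]
  rw [← sub_eq_zero, ← map_sub, quotMk_eq_zero]
  have h1 : I.subtype (diff (X : Fin n → MvPolynomial (Fin n) K) (fun T => (⟨v T, hvI T⟩ : I)) T) =
      diff (X : Fin n → MvPolynomial (Fin n) K) v T :=
    (congrFun (diff_comp X I.subtype fun T => (⟨v T, hvI T⟩ : I)) T).symm
  have h2 : ((diff (X : Fin n → MvPolynomial (Fin n) K)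
      (fun T => (⟨v T, hvI T⟩ : I)) T : I) : MvPolynomial (Fin n) K) - z T
      = - w' T := by
    rw [← Submodule.subtype_apply, h1, hv]
    simp [u]
  rw [Submodule.coe_sub, h2]
  exact J.neg_mem (hwJ' T : w' T ∈ J)

/-- The exponent vector of the squarefree monomial with support `T`. -/
noncomputable def sqfreeExp (T : Finset (Fin n)) : Fin n →₀ ℕ :=
  Finsupp.equivFunOnFinite.symm fun j => if j ∈ T then 1 else 0

theorem sqfreeExp_apply (T : Finset (Fin n)) (j : Fin n) :
    sqfreeExp T j = if j ∈ T then 1 else 0 := rfl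

theorem support_sqfreeExp (T : Finset (Fin n)) : (sqfreeExp T).support = T := by
  ext j; simp [sqfreeExp_apply]

theorem isSqfree_sqfreeExp (T : Finset (Fin n)) : IsSqfree (sqfreeExp T) := fun j => by
  rw [sqfreeExp_apply]; split_ifs <;> omega

theorem sqfreeExp_injective : Function.Injective (sqfreeExp (n := n)) := fun S T h => by
  rw [← support_sqfreeExp S, h, support_sqfreeExp]

theorem IsSqfree.sqfreeExp_support {m : Fin n →₀ ℕ} (hm : IsSqfree m) :
    sqfreeExp m.support = m := by
  ext j
  have := hm j
  rw [sqfreeExp_apply]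
  split_ifs with h <;> simp at h <;> omega

theorem single_add_sqfreeExp_erase {T : Finset (Fin n)} {k : Fin n} (hk : k ∈ T) :
    Finsupp.single k 1 + sqfreeExp (T.erase k) = sqfreeExp T := by
  ext j
  by_cases h : j = k
  · subst h; simp [sqfreeExp_apply, hk]
  · simp [sqfreeExp_apply, h]

open Classical in
theorem rho_eq_card (I J : Ideal (MvPolynomial (Fin n) K)) (t : ℕ) :
    rho K I J t = (Finset.univ.filter fun T : Finset (Fin n) => T.card = t ∧
      monomial (sqfreeExp T) (1 : K) ∈ I ∧ monomial (sqfreeExp T) (1 : K) ∉ J).card := by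
  rw [rho, ← Set.ncard_coe_finset, ← Set.ncard_image_of_injective _ sqfreeExp_injective]
  congr 1
  ext m
  simp only [Set.mem_ofPred_eq, Set.mem_image, Finset.coe_filter, Finset.mem_univ, true_and]
  constructor
  · rintro ⟨hm, hd, hI, hJ⟩
    exact ⟨m.support, by rw [hm.sqfreeExp_support, ← hm.mdeg_eq]; exact ⟨hd, hI, hJ⟩,
      hm.sqfreeExp_support⟩
  · rintro ⟨T, ⟨hT, hI, hJ⟩, rfl⟩
    exact ⟨isSqfree_sqfreeExp T, by rw [(isSqfree_sqfreeExp T).mdeg_eq, support_sqfreeExp, hT],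
      hI, hJ⟩

theorem exists_ne_zero_supported {α : Type*} [Fintype α] (A B : Finset α) (h : B.card < A.card)
    (L : (α → K) →ₗ[K] (α → K)) :
    ∃ y : α → K, y ≠ 0 ∧ (∀ a ∉ A, y a = 0) ∧ ∀ b ∈ B, L y b = 0 := by
  let E : (A → K) →ₗ[K] (α → K) := Function.ExtendByZero.linearMap K Subtype.val
  have hlt : Module.finrank K (B → K) < Module.finrank K (A → K) := by simpa using h
  have := LinearMap.ker_ne_bot_of_finrank_lt
    (f := LinearMap.funLeft K K (Subtype.val : B → α) ∘ₗ L ∘ₗ E) hlt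
  obtain ⟨y, hy, hy0⟩ := (Submodule.ne_bot_iff _).1 this
  refine ⟨E y, fun h0 => hy0 (funext fun a => ?_), fun a ha => ?_, fun b hb => ?_⟩
  · have := congrFun h0 a
    exact (Subtype.val_injective.extend_apply y 0 a).symm.trans this
  · exact Function.extend_apply' _ _ _ (by rintro ⟨⟨a, h⟩, rfl⟩; exact ha h)
  · exact congrFun hy ⟨b, hb⟩

theorem exists_coeff_hom (hJ : GenSqfreeGe K (d + 1) J) {a : Fin n →₀ ℕ}
    (ha : a.support.card ≤ d) :
    ∃ φ : quotMod I J →+ K, ∀ p : I, φ (quotMk I J p) = coeff a (p : MvPolynomial (Fin n) K) := by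
  let f : I →+ K := (coeffAddMonoidHom a).comp I.subtype.toAddMonoidHom
  exact ⟨QuotientAddGroup.lift _ f fun p hp => hJ.coeff_eq_zero hp (by omega), fun p => rfl⟩

theorem coeff_hom_smul_eq_zero (hI : GenSqfreeGe K d I) {T : Finset (Fin n)} (hT : T.card = d)
    {φ : quotMod I J →+ K}
    (hφ : ∀ p : I, φ (quotMk I J p) = coeff (sqfreeExp T) (p : MvPolynomial (Fin n) K))
    {r : MvPolynomial (Fin n) K}
    (hr : r ∈ Ideal.span (Set.range (X : Fin n → MvPolynomial (Fin n) K))) (m : quotMod I J) :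
    φ (r • m) = 0 := by
  induction hr using Submodule.span_induction generalizing m with
  | mem r h =>
    obtain ⟨k, rfl⟩ := h
    obtain ⟨p, rfl⟩ := Submodule.mkQ_surjective _ m
    change φ (X k • quotMk I J p) = 0
    rw [← map_smul, hφ, Submodule.coe_smul, smul_eq_mul, coeff_X_mul_ite, sqfreeExp_apply]
    by_cases hk : k ∈ T
    · rw [if_neg (by simp [hk])]
      refine hI.coeff_eq_zero p.2 ?_
      rw [← single_add_sqfreeExp_erase hk, add_tsub_cancel_left, support_sqfreeExp, ← hT]
      exact Finset.card_erase_lt_of_mem hk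
    · simp [hk]
  | zero => simp
  | add a b _ _ ha hb => rw [add_smul, map_add, ha, hb, add_zero]
  | smul a b _ hb => rw [smul_assoc, smul_comm, hb]

theorem not_acyclic_of_rho_lt (hI : GenSqfreeGe K d I) (hJ : GenSqfreeGe K (d + 1) J)
    (hrho : rho K I J (d + 1) < rho K I (⊥ : Ideal (MvPolynomial (Fin n) K)) d) :
    ¬ Acyclic (X : Fin n → MvPolynomial (Fin n) K) (quotMod I J) (d + 1) := by
  classical
  rw [rho_eq_card, rho_eq_card] at hrho
  obtain ⟨y, hy0, hyA, hyB⟩ := exists_ne_zero_supported _ _ hrho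
    (diff (fun _ : Fin n => (1 : K)) : (Finset (Fin n) → K) →ₗ[K] (Finset (Fin n) → K))
  simp only [Finset.mem_filter, Finset.mem_univ, true_and] at hyA hyB
  have hyA' (T) (hT : y T ≠ 0) : T.card = d ∧ monomial (sqfreeExp T) (1 : K) ∈ I := by
    by_contra h
    exact hT (hyA T fun h' => h ⟨h'.1, h'.2.1⟩)
  have hmem (a : Fin n →₀ ℕ) (c : K) (L : Ideal (MvPolynomial (Fin n) K))
      (h : monomial a (1 : K) ∈ L) : monomial a c ∈ L := by
    have := L.mul_mem_left (C c) h
    rwa [C_mul_monomial, mul_one] at this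
  let u (T : Finset (Fin n)) : MvPolynomial (Fin n) K := monomial (sqfreeExp T) (y T)
  have huI (T) : u T ∈ I := by
    by_cases hT : y T = 0
    · simp [u, hT]
    · exact hmem _ _ _ (hyA' T hT).2
  have hdu (T) : diff (X : Fin n → MvPolynomial (Fin n) K) u T =
      monomial (sqfreeExp T) (diff (fun _ : Fin n => (1 : K)) y T) := by
    rw [diff_apply, diff_apply, map_sum]
    refine Finset.sum_congr rfl fun k hk => ?_
    rw [map_zsmul, one_smul, smul_eq_mul, ← single_add_sqfreeExp_erase hk]
    simp [u, X, monomial_mul]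
  have hduJ (T) : diff (X : Fin n → MvPolynomial (Fin n) K) u T ∈ J := by
    rw [hdu]
    by_cases h : diff (fun _ : Fin n => (1 : K)) y T = 0
    · simp [h]
    · by_contra hJT
      refine h (hyB T ?_)
      rw [diff_apply] at h
      obtain ⟨k, hk, hky⟩ := Finset.exists_ne_zero_of_sum_ne_zero h
      obtain ⟨hc, hm⟩ := hyA' (T.erase k) (fun h0 => hky (by simp [h0]))
      rw [Finset.card_erase_of_mem hk] at hc
      have := Finset.card_pos.2 ⟨k, hk⟩
      refine ⟨by omega, hI.monomial_mem_of_support_subset hm ?_, fun h' => hJT (hmem _ _ _ h')⟩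
      rw [support_sqfreeExp, support_sqfreeExp]
      exact Finset.erase_subset _ _
  intro hac
  obtain ⟨w, hw⟩ := hac (quotMk I J ∘ fun T => ⟨u T, huI T⟩) (fun T hT => by
      have : y T = 0 := by
        by_contra h
        have := (hyA' T h).1
        omega
      simp only [Function.comp_apply, quotMk_eq_zero]
      simp [u, this]) (by
    rw [diff_comp]
    ext T
    simp only [Function.comp_apply, Pi.zero_apply, quotMk_eq_zero]
    have := congrFun (diff_comp X I.subtype fun T => (⟨u T, huI T⟩ : I)) T
    have h := hduJ T
    rw [show u = I.subtype ∘ fun T => (⟨u T, huI T⟩ : I) from rfl, this] at h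
    exact h)
  refine hy0 (_root_.funext fun T => ?_)
  by_contra hT
  have hTd := (hyA' T hT).1
  obtain ⟨φ, hφ⟩ := exists_coeff_hom (I := I) hJ (a := sqfreeExp T)
    (by rw [support_sqfreeExp, hTd])
  have h1 := hφ ⟨u T, huI T⟩
  have h2 := congrFun hw T
  simp only [Function.comp_apply] at h2
  rw [← h2, diff_apply, map_sum, Finset.sum_eq_zero] at h1
  · exact hT (by simpa [u] using h1.symm)
  · intro k _
    rw [map_zsmul, coeff_hom_smul_eq_zero hI hTd hφ (Ideal.subset_span ⟨k, rfl⟩), smul_zero]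

theorem top_ne_smul_top_of_rho_pos (hI : GenSqfreeGe K d I) (hJ : GenSqfreeGe K (d + 1) J)
    (hrho : 0 < rho K I (⊥ : Ideal (MvPolynomial (Fin n) K)) d)
    {L : Ideal (MvPolynomial (Fin n) K)}
    (hL : L ≤ Ideal.span (Set.range (X : Fin n → MvPolynomial (Fin n) K))) :
    (⊤ : Submodule (MvPolynomial (Fin n) K) (quotMod I J)) ≠ L • ⊤ := by
  classical
  intro htop
  rw [rho_eq_card, Finset.card_pos] at hrho
  obtain ⟨T, hT⟩ := hrho
  simp only [Finset.mem_filter, Finset.mem_univ, true_and] at hT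
  obtain ⟨hTd, hTI, -⟩ := hT
  obtain ⟨φ, hφ⟩ := exists_coeff_hom (I := I) hJ (a := sqfreeExp T)
    (by rw [support_sqfreeExp, hTd])
  have hzero : ∀ m : quotMod I J, φ m = 0 := fun m => by
    have hm : m ∈ L • (⊤ : Submodule (MvPolynomial (Fin n) K) (quotMod I J)) :=
      htop ▸ Submodule.mem_top
    induction hm using Submodule.smul_induction_on' with
    | smul r hr m _ => exact coeff_hom_smul_eq_zero hI hTd hφ (hL hr) m
    | add a _ b _ ha hb => rw [map_add, ha, hb, add_zero]
  have := hφ ⟨_, hTI⟩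
  rw [hzero] at this
  simp at this

end SquarefreeMonomialIdeal

theorem depth_eq_d_of_rho {K : Type*} [Field K] {n d : ℕ}
    (I J : Ideal (MvPolynomial (Fin n) K)) (hJI : J < I)
    (hI : GenSqfreeGe K d I) (hJ : GenSqfreeGe K (d + 1) J)
    (hrho : rho K I J (d + 1) < rho K I (⊥ : Ideal (MvPolynomial (Fin n) K)) d) :
    mdepth K n (quotMod I J) = d := by
  refine IsGreatest.csSup_eq ⟨?_, ?_⟩
  · obtain ⟨rs, hlen, hmem, hrs⟩ :=
      Koszul.exists_isWeaklyRegular_of_acyclic (acyclic_quotMod hJI.le hI hJ)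
    refine ⟨rs, hlen, hmem, hrs, top_ne_smul_top_of_rho_pos hI hJ (by omega) ?_⟩
    exact Ideal.span_le.2 hmem
  · rintro k ⟨rs, rfl, hmem, hrs⟩
    by_contra! hlt
    exact not_acyclic_of_rho_lt hI hJ hrho
      ((Koszul.acyclic_of_isWeaklyRegular rs hmem hrs.toIsWeaklyRegular).mono hlt)
end

section
/- Let S = K[x_1,...,x_n], let I be generated by a single square-free monomial f of degree d, and let J ⊊ I be a square-free monomial ideal generated in degrees ≥ d+1. If ρ_{d+1}(I\J) > ρ_{d+2}(I\J) + 1, then depth_S(I/J) = d+1. -/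
open MvPolynomial

/-- `M` has a regular sequence of length `k` with all terms in `𝔞`. -/
def HasRegSeq {R : Type*} [CommRing R] (𝔞 : Ideal R) (M : Type*) [AddCommGroup M] [Module R M]
    (k : ℕ) : Prop :=
  ∃ rs : List R, rs.length = k ∧ (∀ r ∈ rs, r ∈ 𝔞) ∧ RingTheory.Sequence.IsRegular M rs

section HasRegSeq

open RingTheory.Sequence CategoryTheory Abelian Pointwise

variable {R : Type*} [CommRing R] {𝔞 : Ideal R}

theorem HasRegSeq.congr {M N : Type*} [AddCommGroup M] [Module R M] [AddCommGroup N] [Module R N]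
    (e : M ≃ₗ[R] N) (k : ℕ) : HasRegSeq 𝔞 M k ↔ HasRegSeq 𝔞 N k := by
  simp only [HasRegSeq, e.isRegular_congr]

theorem HasRegSeq.mono {M : Type*} [AddCommGroup M] [Module R M] {k l : ℕ}
    (h : HasRegSeq 𝔞 M k) (hl : l ≤ k) : HasRegSeq 𝔞 M l := by
  obtain ⟨rs, hlen, hmem, hreg⟩ := h
  refine ⟨rs.take l, by simp [hlen, hl], fun r hr => hmem r (List.mem_of_mem_take hr), ?_, ?_⟩
  · have := hreg.toIsWeaklyRegular
    rw [← List.take_append_drop l rs, isWeaklyRegular_append_iff] at this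
    exact this.1
  · intro htop
    refine hreg.top_ne_smul (le_antisymm ?_ le_top)
    calc (⊤ : Submodule R M) = Ideal.ofList (rs.take l) • ⊤ := htop
      _ ≤ Ideal.ofList rs • ⊤ := Submodule.smul_mono_left
        (Ideal.span_mono fun _ hr => List.mem_of_mem_take hr)

/-- Dividing a quotient ring further by one element. -/
noncomputable def quotSMulTopQuotEquiv (Q : Ideal R) (x : R) :
    QuotSMulTop x (R ⧸ Q) ≃ₗ[R] R ⧸ (Q ⊔ Ideal.span {x}) :=
  let φ : R →ₗ[R] QuotSMulTop x (R ⧸ Q) :=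
    (x • (⊤ : Submodule R (R ⧸ Q))).mkQ ∘ₗ Submodule.mkQ Q
  have hsurj : Function.Surjective φ :=
    (Submodule.mkQ_surjective _).comp (Submodule.mkQ_surjective _)
  have hker : LinearMap.ker φ = Q ⊔ Ideal.span {x} := by
    rw [LinearMap.ker_comp, Submodule.ker_mkQ, ← Submodule.ideal_span_singleton_smul,
      Submodule.comap_smul_top_of_surjective _ _ (Submodule.mkQ_surjective _), Submodule.ker_mkQ,
      sup_comm, Ideal.smul_eq_mul, Ideal.mul_top]
  ((Submodule.quotEquivOfEq _ _ hker.symm).trans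
    (φ.quotKerEquivOfSurjective hsurj)).symm

theorem smul_top_quotient_lt_top {Q : Ideal R} (hQ : Q ≤ 𝔞) (h𝔞 : 𝔞 ≠ ⊤) :
    𝔞 • (⊤ : Submodule R (R ⧸ Q)) < ⊤ := by
  rw [lt_top_iff_ne_top]
  intro h
  apply h𝔞
  have := congrArg (Submodule.comap (Submodule.mkQ Q)) h
  rw [Submodule.comap_smul_top_of_surjective _ _ (Submodule.mkQ_surjective _), Submodule.ker_mkQ,
    Submodule.comap_top, Ideal.smul_eq_mul, Ideal.mul_top, sup_eq_left.mpr hQ] at this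
  exact this

theorem smul_top_quotSMulTop_ne_top {M : Type*} [AddCommGroup M] [Module R M] {x : R} (hx : x ∈ 𝔞)
    (h : 𝔞 • (⊤ : Submodule R M) ≠ ⊤) : 𝔞 • (⊤ : Submodule R (QuotSMulTop x M)) ≠ ⊤ := by
  intro htop
  have := congrArg (Submodule.comap (Submodule.mkQ _)) htop
  rw [Submodule.comap_smul_top_of_surjective 𝔞 _ (Submodule.mkQ_surjective _),
    Submodule.ker_mkQ, Submodule.comap_top, ← Submodule.ideal_span_singleton_smul,
    sup_eq_left.mpr
      (Submodule.smul_mono_left ((Ideal.span_singleton_le_iff_mem 𝔞).mpr hx))] at this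
  exact h this

/-- Passing to the quotient by a regular element of `𝔞` lowers the possible lengths of regular
sequences in `𝔞` by exactly one. -/
theorem hasRegSeq_quotient_sup_span_iff [IsNoetherianRing R] {Q : Ideal R} {x : R} (hx : x ∈ 𝔞)
    (hQ : Q ≤ 𝔞) (h𝔞 : 𝔞 ≠ ⊤) (hreg : IsSMulRegular (R ⧸ Q) x) (k : ℕ) :
    HasRegSeq 𝔞 (R ⧸ (Q ⊔ Ideal.span {x})) k ↔ HasRegSeq 𝔞 (R ⧸ Q) (k + 1) := by
  rw [← HasRegSeq.congr (quotSMulTopQuotEquiv Q x)]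
  constructor
  · rintro ⟨rs, hlen, hmem, h⟩
    exact ⟨x :: rs, by simp [hlen], by simpa [hx] using hmem, (isRegular_cons_iff _ _ _).2 ⟨hreg, h⟩⟩
  · intro h
    have hlt : 𝔞 • (⊤ : Submodule R (QuotSMulTop x (R ⧸ Q))) < ⊤ := by
      refine lt_top_iff_ne_top.mpr (smul_top_quotSMulTop_ne_top hx (smul_top_quotient_lt_top hQ h𝔞).ne)
    have hM := ((ModuleCat.exists_isRegular_tfae 𝔞 (k + 1) (ModuleCat.of R (R ⧸ Q))
      (smul_top_quotient_lt_top hQ h𝔞)).out 1 3).mpr h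
    refine ((ModuleCat.exists_isRegular_tfae 𝔞 k (ModuleCat.of R (QuotSMulTop x (R ⧸ Q)))
      hlt).out 1 3).mp fun i hi => ?_
    have zero1 := AddCommGrpCat.isZero_of_iff_subsingleton.mpr (hM i (by omega))
    have zero2 := AddCommGrpCat.isZero_of_iff_subsingleton.mpr (hM (i + 1) (by omega))
    exact AddCommGrpCat.subsingleton_of_isZero <| ShortComplex.Exact.isZero_of_both_zeros
      ((Ext.covariant_sequence_exact₃' _ (IsSMulRegular.smulShortComplex_shortExact
        (M := ModuleCat.of R (R ⧸ Q)) hreg)) i (i + 1) rfl)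
      (zero1.eq_zero_of_src _) (zero2.eq_zero_of_tgt _)

theorem isSMulRegular_quotient_iff {Q : Ideal R} {x : R} :
    IsSMulRegular (R ⧸ Q) x ↔ ∀ g, x * g ∈ Q → g ∈ Q := by
  rw [isSMulRegular_iff_right_eq_zero_of_smul, Ideal.Quotient.mk_surjective.forall]
  refine forall_congr' fun g => ?_
  rw [← Ideal.Quotient.eq_zero_iff_mem, ← Ideal.Quotient.eq_zero_iff_mem, map_mul]
  rfl

/-- An ideal obstruction to regular sequences of length two: `𝔟` and `𝔠` cut `R ⧸ Q` into two
pieces meeting only at `V(𝔞)`. -/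
theorem not_hasRegSeq_two {Q 𝔟 𝔠 𝔪 : Ideal R} (h𝔪 : 𝔪 ≠ ⊤) (hsup : 𝔞 = 𝔟 ⊔ 𝔠)
    (hmul : 𝔟 * 𝔠 ≤ Q) {y z : R} (hy : y ∈ 𝔟) (hz : z ∈ 𝔠)
    (hyQ : ∀ g, y * g ∈ Q → g ∈ 𝔪) (hzQ : ∀ g, z * g ∈ Q → g ∈ 𝔪) :
    ¬ HasRegSeq 𝔞 (R ⧸ Q) 2 := by
  rintro ⟨rs, hlen, hmem, hreg⟩
  obtain ⟨r, s, rfl⟩ := List.length_eq_two.mp hlen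
  rw [isRegular_cons_iff, (quotSMulTopQuotEquiv Q r).isRegular_congr, isRegular_cons_iff,
    isSMulRegular_quotient_iff, isSMulRegular_quotient_iff] at hreg
  obtain ⟨hr, hs, -⟩ := hreg
  have hrm : r ∈ 𝔟 ⊔ 𝔠 := hsup ▸ hmem r (by simp)
  have hsm : s ∈ 𝔟 ⊔ 𝔠 := hsup ▸ hmem s (by simp)
  obtain ⟨r₁, hr₁, r₂, hr₂, rfl⟩ := Submodule.mem_sup.mp hrm
  obtain ⟨s₁, hs₁, s₂, hs₂, rfl⟩ := Submodule.mem_sup.mp hsm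
  have key {u v : R} (hu : u ∈ 𝔟) (hv : v ∈ 𝔠) : u * v ∈ Q := hmul (Ideal.mul_mem_mul hu hv)
  have h1 : r₁ ∈ Q ⊔ Ideal.span {r₁ + r₂} := by
    apply hs
    have : (s₁ + s₂) * r₁ = (r₁ * s₂ - s₁ * r₂) + s₁ * (r₁ + r₂) := by ring
    rw [this]
    exact Submodule.add_mem_sup (sub_mem (key hr₁ hs₂) (key hs₁ hr₂))
      (Ideal.mul_mem_left _ _ (Ideal.mem_span_singleton_self _))
  obtain ⟨q, hq, t, ht, hqt⟩ := Submodule.mem_sup.mp h1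
  obtain ⟨b, rfl⟩ := Ideal.mem_span_singleton'.mp ht
  have h2 : 1 - b ∈ 𝔪 := by
    apply hyQ
    apply hr
    have : (r₁ + r₂) * (y * (1 - b)) = y * r₂ + y * q := by linear_combination (-y) * hqt
    rw [this]
    exact add_mem (key hy hr₂) (Ideal.mul_mem_left _ _ hq)
  have h3 : b ∈ 𝔪 := by
    apply hzQ
    apply hr
    have : (r₁ + r₂) * (z * b) = r₁ * z - z * q := by linear_combination z * hqt
    rw [this]
    exact sub_mem (key hr₁ hz) (Ideal.mul_mem_left _ _ hq)
  exact h𝔪 ((Ideal.eq_top_iff_one _).mpr (by simpa using add_mem h2 h3))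

end HasRegSeq

section MonomialIdeal

variable {K : Type*} [Field K] {σ : Type*}

variable (K) in
/-- The ideal generated by the monomials with exponents in `G`. -/
noncomputable abbrev monomialIdeal (G : Set (σ →₀ ℕ)) : Ideal (MvPolynomial σ K) :=
  Ideal.span ((fun m => monomial m (1 : K)) '' G)

variable (K σ) in
/-- The ideal generated by all variables. -/
noncomputable abbrev variableIdeal : Ideal (MvPolynomial σ K) :=
  Ideal.span (Set.range X)

theorem monomial_mem_monomialIdeal {G : Set (σ →₀ ℕ)} {m : σ →₀ ℕ} :
    monomial m (1 : K) ∈ monomialIdeal K G ↔ ∃ s ∈ G, s ≤ m := by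
  classical
  rw [mem_ideal_span_monomial_image]
  simp [support_monomial]

theorem mem_variableIdeal_iff {p : MvPolynomial σ K} :
    p ∈ variableIdeal K σ ↔ constantCoeff p = 0 := by
  rw [variableIdeal, ← Set.image_univ, mem_ideal_span_X_image]
  constructor
  · intro h
    by_contra h0
    obtain ⟨i, -, hi⟩ := h 0 (mem_support_iff.mpr h0)
    exact hi rfl
  · intro h m hm
    by_contra! hm0
    have : m = 0 := by
      ext i
      exact hm0 i (Set.mem_univ i)
    exact mem_support_iff.mp hm (this ▸ h)

theorem variableIdeal_ne_top : variableIdeal K σ ≠ ⊤ := by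
  rw [Ideal.ne_top_iff_one, mem_variableIdeal_iff]
  simp

theorem monomialIdeal_le_variableIdeal {G : Set (σ →₀ ℕ)} (hG : 0 ∉ G) :
    monomialIdeal K G ≤ variableIdeal K σ := by
  classical
  rw [Ideal.span_le]
  rintro _ ⟨m, hm, rfl⟩
  rw [SetLike.mem_coe, mem_variableIdeal_iff]
  have : m ≠ 0 := fun h => hG (h ▸ hm)
  simp [constantCoeff_eq, coeff_monomial, this]

theorem monomialIdeal_insert_single (G : Set (σ →₀ ℕ)) (i : σ) :
    monomialIdeal K (insert (Finsupp.single i 1) G) = monomialIdeal K G ⊔ Ideal.span {X i} := by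
  rw [monomialIdeal, Set.image_insert_eq, Ideal.span_insert, sup_comm]
  rfl

/-- A monomial ideal not containing a variable `X i` can only absorb multiples `X i * g` with `g`
in the ideal of variables. -/
theorem mem_variableIdeal_of_X_mul_mem {G : Set (σ →₀ ℕ)} {i : σ}
    (hi : (X i : MvPolynomial σ K) ∉ monomialIdeal K G) {g : MvPolynomial σ K}
    (hg : X i * g ∈ monomialIdeal K G) : g ∈ variableIdeal K σ := by
  rw [mem_variableIdeal_iff]
  by_contra h0
  rw [mem_ideal_span_monomial_image] at hg
  refine hi (monomial_mem_monomialIdeal.mpr (hg (Finsupp.single i 1) ?_))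
  rw [mem_support_iff, ← add_zero (Finsupp.single i 1), coeff_X_mul]
  exact h0

theorem isPrime_span_X_image (A : Set σ) :
    (Ideal.span ((X : σ → MvPolynomial σ K) '' A)).IsPrime := by
  classical
  let φ : MvPolynomial σ K →ₐ[K] MvPolynomial σ K := aeval fun i => if i ∈ A then 0 else X i
  have hmk : (Ideal.Quotient.mkₐ K (Ideal.span ((X : σ → MvPolynomial σ K) '' A))).comp φ =
      Ideal.Quotient.mkₐ K _ := by
    ext i
    by_cases hi : i ∈ A
    · have : Ideal.Quotient.mk (Ideal.span ((X : σ → MvPolynomial σ K) '' A)) (X i) = 0 :=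
        Ideal.Quotient.eq_zero_iff_mem.mpr (Ideal.subset_span ⟨i, hi, rfl⟩)
      simp [φ, hi, this]
    · simp [φ, hi]
  have hker : Ideal.span ((X : σ → MvPolynomial σ K) '' A) = RingHom.ker φ := by
    apply le_antisymm
    · rw [Ideal.span_le]
      rintro _ ⟨i, hi, rfl⟩
      simp [φ, hi]
    · intro g hg
      rw [RingHom.mem_ker] at hg
      have := DFunLike.congr_fun hmk g
      rw [AlgHom.comp_apply, hg, map_zero] at this
      exact Ideal.Quotient.eq_zero_iff_mem.mp this.symm
  rw [hker]
  exact RingHom.ker_isPrime _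

/-- Regularity criterion modulo a monomial ideal: every monomial outside the ideal is supported on
a set `F` of variables such that no generator is supported on `F` and `r` does not vanish
when the variables outside `F` are set to zero. -/
theorem isSMulRegular_quotient_monomialIdeal {G : Set (σ →₀ ℕ)} {r : MvPolynomial σ K}
    (h : ∀ m : σ →₀ ℕ, (∀ s ∈ G, ¬ s ≤ m) → ∃ F : Set σ, ↑m.support ⊆ F ∧
      (∀ s ∈ G, ¬ ↑s.support ⊆ F) ∧ r ∉ Ideal.span ((X : σ → MvPolynomial σ K) '' Fᶜ)) :
    IsSMulRegular (MvPolynomial σ K ⧸ monomialIdeal K G) r := by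
  classical
  rw [isSMulRegular_quotient_iff]
  intro g hg
  by_contra hgG
  rw [mem_ideal_span_monomial_image] at hgG
  push Not at hgG
  obtain ⟨m, hm, hmG⟩ := hgG
  obtain ⟨F, hmF, hGF, hr⟩ := h m hmG
  have hle : monomialIdeal K G ≤ Ideal.span ((X : σ → MvPolynomial σ K) '' Fᶜ) := by
    rw [Ideal.span_le]
    rintro _ ⟨s, hs, rfl⟩
    obtain ⟨j, hj, hjF⟩ := Set.not_subset.mp (hGF s hs)
    rw [SetLike.mem_coe, mem_ideal_span_X_image]
    intro t ht
    obtain rfl : t = s := by simpa [support_monomial] using ht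
    exact ⟨j, hjF, by simpa using hj⟩
  obtain hg' := ((isPrime_span_X_image (K := K) Fᶜ).mem_or_mem (hle hg)).resolve_left hr
  obtain ⟨j, hjF, hj⟩ := mem_ideal_span_X_image.mp hg' m hm
  exact hjF (hmF (by simpa using hj))

end MonomialIdeal

section Squarefree

variable {K : Type*} [Field K] {n : ℕ}

theorem monomial_mul_mem_monomialIdeal {σ : Type*} {G : Set (σ →₀ ℕ)} {f : σ →₀ ℕ}
    {g : MvPolynomial σ K} :
    monomial f 1 * g ∈ monomialIdeal K G ↔ g ∈ monomialIdeal K ((· - f) '' G) := by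
  classical
  rw [mem_ideal_span_monomial_image, mem_ideal_span_monomial_image]
  constructor
  · intro h u hu
    obtain ⟨s, hs, hle⟩ := h (f + u) (by
      rw [mem_support_iff, coeff_monomial_mul, one_mul]
      exact mem_support_iff.mp hu)
    exact ⟨s - f, ⟨s, hs, rfl⟩, tsub_le_iff_left.mpr hle⟩
  · intro h t ht
    rw [mem_support_iff, coeff_monomial_mul'] at ht
    split_ifs at ht with hft
    · obtain ⟨_, ⟨s, hs, rfl⟩, hle⟩ := h (t - f) (by simpa using ht)
      refine ⟨s, hs, ?_⟩
      have := tsub_le_iff_left.mp hle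
      rwa [add_tsub_cancel_of_le hft] at this
    · exact absurd rfl ht

/-- For principal `I`, the module `I/J` is cyclic, with annihilator the colon ideal. -/
noncomputable def quotModEquiv (f : Fin n →₀ ℕ) (G : Set (Fin n →₀ ℕ))
    (I J : Ideal (MvPolynomial (Fin n) K)) (hI : I = Ideal.span {monomial f (1 : K)})
    (hJ : J = monomialIdeal K G) :
    (MvPolynomial (Fin n) K ⧸ monomialIdeal K ((· - f) '' G)) ≃ₗ[MvPolynomial (Fin n) K]
      quotMod I J :=
  let x : I := ⟨monomial f 1, hI ▸ Ideal.mem_span_singleton_self _⟩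
  let φ : MvPolynomial (Fin n) K →ₗ[MvPolynomial (Fin n) K] quotMod I J :=
    Submodule.mkQ _ ∘ₗ LinearMap.toSpanSingleton _ I x
  have hsurj : Function.Surjective φ := by
    refine (Submodule.mkQ_surjective _).comp ?_
    rintro ⟨p, hp⟩
    obtain ⟨a, rfl⟩ := Ideal.mem_span_singleton'.mp (hI ▸ hp)
    exact ⟨a, rfl⟩
  have hker : LinearMap.ker φ = monomialIdeal K ((· - f) '' G) := by
    ext g
    rw [LinearMap.ker_comp, Submodule.ker_mkQ, Submodule.mem_comap, Submodule.mem_comap,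
      ← monomial_mul_mem_monomialIdeal, ← hJ, mul_comm]
    rfl
  (Submodule.quotEquivOfEq _ _ hker.symm).trans (φ.quotKerEquivOfSurjective hsurj)

theorem isSMulRegular_X {σ : Type*} {G : Set (σ →₀ ℕ)} (hG : ∀ s ∈ G, ∀ j, s j ≤ 1) {i : σ}
    (hi : ∀ s ∈ G, s i = 0) :
    IsSMulRegular (MvPolynomial σ K ⧸ monomialIdeal K G) (X i : MvPolynomial σ K) := by
  classical
  refine isSMulRegular_quotient_monomialIdeal fun m hm => ⟨↑m.support ∪ {i}, by simp, ?_, ?_⟩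
  · intro s hs hsub
    refine hm s hs fun j => ?_
    by_cases hj : s j = 0
    · simp [hj]
    · have := hsub (Finsupp.mem_support_iff.mpr hj)
      rcases this with h | rfl
      · have h1 := Nat.pos_of_ne_zero (Finsupp.mem_support_iff.mp h)
        have := hG s hs j
        omega
      · exact absurd (hi s hs) hj
  · rw [mem_ideal_span_X_image]
    push Not
    refine ⟨Finsupp.single i 1, by simp, fun j hj => ?_⟩
    rw [Finsupp.single_eq_of_ne]
    rintro rfl
    simp at hj

theorem isSMulRegular_sum_X {σ : Type*} [Fintype σ] {G : Set (σ →₀ ℕ)}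
    (hG : ∀ s ∈ G, ∀ j, s j ≤ 1) {u : σ}
    (hu : (X u : MvPolynomial σ K) ∉ monomialIdeal K G) :
    IsSMulRegular (MvPolynomial σ K ⧸ monomialIdeal K G) (∑ i, X i : MvPolynomial σ K) := by
  classical
  have hsum (F : Set σ) (hF : F.Nonempty) :
      (∑ i, X i : MvPolynomial σ K) ∉ Ideal.span ((X : σ → MvPolynomial σ K) '' Fᶜ) := by
    obtain ⟨i, hi⟩ := hF
    rw [mem_ideal_span_X_image]
    push Not
    refine ⟨Finsupp.single i 1, ?_, fun j hj => ?_⟩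
    · simp [coeff_sum, coeff_X, Finsupp.single_left_inj]
    · rw [Finsupp.single_eq_of_ne]
      rintro rfl
      exact hj hi
  have hle (m : σ →₀ ℕ) (s) (hs : s ∈ G) (hsub : (s.support : Set σ) ⊆ m.support) : s ≤ m := by
    intro j
    by_cases hj : s j = 0
    · simp [hj]
    · have h1 := Nat.pos_of_ne_zero (Finsupp.mem_support_iff.mp
        (hsub (Finsupp.mem_support_iff.mpr hj)))
      have := hG s hs j
      omega
  refine isSMulRegular_quotient_monomialIdeal fun m hm => ?_
  by_cases hm0 : m = 0
  · refine ⟨(Finsupp.single u 1).support, by simp [hm0], fun s hs hsub => hu ?_, hsum _ ?_⟩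
    · exact monomial_mem_monomialIdeal.mpr ⟨s, hs, hle _ s hs hsub⟩
    · exact ⟨u, by simp⟩
  · refine ⟨m.support, subset_rfl, fun s hs hsub => hm s hs (hle m s hs hsub), hsum _ ?_⟩
    simpa using hm0

/-- Adding variables not occurring in the generators of a squarefree monomial ideal. -/
theorem hasRegSeq_union_single_iff {σ : Type*} [Finite σ] {G : Set (σ →₀ ℕ)}
    (hG : ∀ s ∈ G, ∀ j, s j ≤ 1) (hG0 : 0 ∉ G) (A : Finset σ) (hA : ∀ s ∈ G, ∀ i ∈ A, s i = 0)
    (k : ℕ) :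
    HasRegSeq (variableIdeal K σ)
      (MvPolynomial σ K ⧸ monomialIdeal K (G ∪ (Finsupp.single · 1) '' A)) k ↔
      HasRegSeq (variableIdeal K σ) (MvPolynomial σ K ⧸ monomialIdeal K G) (k + A.card) := by
  classical
  induction A using Finset.induction_on generalizing k with
  | empty => rw [Finset.coe_empty, Set.image_empty, Set.union_empty, Finset.card_empty, add_zero]
  | insert i A hi ih =>
    rw [Finset.coe_insert, Set.image_insert_eq, Set.union_insert, monomialIdeal_insert_single,
      hasRegSeq_quotient_sup_span_iff (Ideal.subset_span (Set.mem_range_self i)) _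
        variableIdeal_ne_top,
      ih (fun s hs j hj => hA s hs j (Finset.mem_insert_of_mem hj)), Finset.card_insert_of_notMem hi,
      add_right_comm, add_assoc]
    · refine isSMulRegular_X ?_ ?_
      · rintro s (hs | ⟨j, -, rfl⟩) l
        · exact hG s hs l
        · rw [Finsupp.single_apply]
          split_ifs <;> simp
      · rintro s (hs | ⟨j, hj, rfl⟩)
        · exact hA s hs i (Finset.mem_insert_self _ _)
        · rw [Finsupp.single_eq_of_ne]
          rintro rfl
          exact hi hj
    · refine monomialIdeal_le_variableIdeal ?_
      rintro (h | ⟨j, -, hj⟩)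
      · exact hG0 h
      · simp at hj

theorem mdeg_eq_degree (m : Fin n →₀ ℕ) : mdeg m = m.degree := rfl

theorem mem_span_monomial_singleton_iff {f m : Fin n →₀ ℕ} :
    monomial m (1 : K) ∈ Ideal.span {monomial f (1 : K)} ↔ f ≤ m := by
  have := monomial_mem_monomialIdeal (K := K) (G := {f}) (m := m)
  simpa [monomialIdeal] using this

/-- The vertices of the simplicial complex attached to `I/J`. -/
theorem rho_succ_le_ncard {f : Fin n →₀ ℕ} {G : Set (Fin n →₀ ℕ)} {d : ℕ} (hfd : mdeg f = d) :
    rho K (Ideal.span {monomial f (1 : K)}) (monomialIdeal K G) (d + 1) ≤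
      Set.ncard {i : Fin n | f i = 0 ∧ (X i : MvPolynomial (Fin n) K) ∉
        monomialIdeal K ((· - f) '' G)} := by
  refine le_trans (Set.ncard_le_ncard ?_ (Set.toFinite _))
    (Set.ncard_image_le (f := fun i => f + Finsupp.single i 1) (Set.toFinite _))
  rintro m ⟨hmsq, hmd, hmI, hmJ⟩
  have hfm := mem_span_monomial_singleton_iff.mp hmI
  obtain ⟨e, rfl⟩ := exists_add_of_le hfm
  rw [mdeg_eq_degree, map_add, ← mdeg_eq_degree, hfd, add_right_inj] at hmd
  obtain ⟨i, rfl⟩ := (Finsupp.sum_eq_one_iff e).mp hmd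
  refine ⟨i, ⟨?_, ?_⟩, rfl⟩
  · have := hmsq i
    simp at this
    omega
  · rwa [← monomial_mul_mem_monomialIdeal, X, monomial_mul, one_mul]

theorem finite_setOf_isSqfree : {m : Fin n →₀ ℕ | IsSqfree m}.Finite :=
  (Set.finite_Iic (Finsupp.equivFunOnFinite.symm fun _ => 1)).subset fun _ hm j => hm j

/-- If the complex attached to `I/J` has too few edges, its vertices split into two
nonempty parts without edges between them. -/
theorem exists_disconnection {f : Fin n →₀ ℕ} {G : Set (Fin n →₀ ℕ)} {d : ℕ}
    (hfsq : IsSqfree f) (hfd : mdeg f = d)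
    (hrho : rho K (Ideal.span {monomial f (1 : K)}) (monomialIdeal K G) (d + 2) + 1 <
      rho K (Ideal.span {monomial f (1 : K)}) (monomialIdeal K G) (d + 1)) :
    ∃ W : Set (Fin n), (∃ u ∈ W, f u = 0 ∧ (X u : MvPolynomial (Fin n) K) ∉
        monomialIdeal K ((· - f) '' G)) ∧
      (∃ v ∉ W, f v = 0 ∧ (X v : MvPolynomial (Fin n) K) ∉ monomialIdeal K ((· - f) '' G)) ∧
      ∀ i ∈ W, ∀ j ∉ W, f i = 0 → f j = 0 →
        (X i * X j : MvPolynomial (Fin n) K) ∈ monomialIdeal K ((· - f) '' G) := by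
  classical
  set V : Set (Fin n) := {i : Fin n | f i = 0 ∧ (X i : MvPolynomial (Fin n) K) ∉
        monomialIdeal K ((· - f) '' G)} with hV
  have hVcard := hrho.trans_le (rho_succ_le_ncard hfd)
  rw [← hV] at hVcard
  let Γ : SimpleGraph V :=
    { Adj := fun i j => i ≠ j ∧ (X (i : Fin n) * X (j : Fin n) : MvPolynomial (Fin n) K) ∉
        monomialIdeal K ((· - f) '' G)
      symm := ⟨fun i j h => ⟨h.1.symm, by rw [mul_comm]; exact h.2⟩⟩
      loopless := ⟨fun i h => h.1 rfl⟩ }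
  let e : Sym2 V → (Fin n →₀ ℕ) := Sym2.lift
    ⟨fun i j => f + Finsupp.single (i : Fin n) 1 + Finsupp.single (j : Fin n) 1,
      fun i j => add_right_comm _ _ _⟩
  have he (z : Sym2 V) (v : V) : v ∈ z ↔ f v < e z v := by
    induction z with
    | _ i j =>
      rw [Sym2.mem_iff]
      simp only [e, Sym2.lift_mk, Finsupp.add_apply, Finsupp.single_apply, Subtype.ext_iff]
      split_ifs <;> grind
  have hinj : Function.Injective e := fun z w hzw => Sym2.ext fun v => by rw [he, he, hzw]
  have hmaps : ∀ z ∈ Γ.edgeSet, e z ∈ {m : Fin n →₀ ℕ | IsSqfree m ∧ mdeg m = d + 2 ∧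
      monomial m (1 : K) ∈ Ideal.span {monomial f (1 : K)} ∧
      monomial m (1 : K) ∉ monomialIdeal K G} := by
    intro z
    induction z with
    | _ i j =>
      intro hz
      obtain ⟨hij, hnot⟩ : Γ.Adj i j := hz
      have hij' : (i : Fin n) ≠ j := fun h => hij (Subtype.ext h)
      simp only [e, Sym2.lift_mk, Set.mem_ofPred_eq]
      refine ⟨fun l => ?_, ?_, ?_, ?_⟩
      · have := hfsq l
        have hi := i.2.1
        have hj := j.2.1
        simp only [Finsupp.add_apply, Finsupp.single_apply]
        split_ifs <;> grind
      · rw [mdeg_eq_degree, map_add, map_add, ← mdeg_eq_degree, hfd]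
        simp
      · rw [mem_span_monomial_singleton_iff, add_assoc]
        exact le_self_add
      · rwa [← monomial_mul_mem_monomialIdeal, X, X, monomial_mul, monomial_mul, one_mul, one_mul,
          ← add_assoc] at hnot
  have hE : Nat.card Γ.edgeSet ≤
      rho K (Ideal.span {monomial f (1 : K)}) (monomialIdeal K G) (d + 2) :=
    Set.ncard_le_ncard_of_injOn e hmaps hinj.injOn
      (finite_setOf_isSqfree.subset fun _ h => h.1)
  have hnconn : ¬ Γ.Connected := fun h => by
    have := h.card_vert_le_card_edgeSet_add_one
    rw [Nat.card_coe_set_eq] at this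
    omega
  have hne : Nonempty V := by
    rw [Set.nonempty_coe_sort]
    exact Set.nonempty_of_ncard_ne_zero (by omega)
  have hnpre : ¬ Γ.Preconnected := fun h => hnconn ⟨h⟩
  unfold SimpleGraph.Preconnected at hnpre
  push Not at hnpre
  obtain ⟨u, v, huv⟩ := hnpre
  refine ⟨{i | ∃ h : i ∈ V, Γ.Reachable u ⟨i, h⟩}, ⟨u, ⟨u.2, .refl u⟩, u.2⟩,
    ⟨v, fun ⟨_, h⟩ => huv h, v.2⟩, ?_⟩
  rintro i ⟨hi, hui⟩ j hj - hfj
  by_contra hmem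
  have hjV : j ∈ V := ⟨hfj, fun h => hmem (Ideal.mul_mem_left _ _ h)⟩
  refine hj ⟨hjV, hui.trans (SimpleGraph.Adj.reachable ⟨?_, hmem⟩)⟩
  rintro h
  obtain rfl := Subtype.ext_iff.mp h
  exact hj ⟨hi, hui⟩

theorem X_mem_monomialIdeal_union_single {σ : Type*} {G : Set (σ →₀ ℕ)} {A : Set σ} {i : σ}
    (hi : i ∉ A) : (X i : MvPolynomial σ K) ∈ monomialIdeal K (G ∪ (Finsupp.single · 1) '' A) ↔
      (X i : MvPolynomial σ K) ∈ monomialIdeal K G := by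
  classical
  rw [X, monomial_mem_monomialIdeal, monomial_mem_monomialIdeal]
  constructor
  · rintro ⟨s, hs | ⟨j, hj, rfl⟩, hle⟩
    · exact ⟨s, hs, hle⟩
    · rw [Finsupp.single_le_iff, Finsupp.single_apply] at hle
      split_ifs at hle with h
      · exact absurd (h ▸ hj) hi
      · omega
  · rintro ⟨s, hs, hle⟩
    exact ⟨s, Or.inl hs, hle⟩

theorem mdepth_eq_of_hasRegSeq {M : Type*} [AddCommGroup M] [Module (MvPolynomial (Fin n) K) M]
    {k : ℕ} (h : HasRegSeq (variableIdeal K (Fin n)) M k)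
    (h' : ¬ HasRegSeq (variableIdeal K (Fin n)) M (k + 1)) : mdepth K n M = k := by
  refine IsGreatest.csSup_eq ⟨h, fun l hl => ?_⟩
  by_contra! hlt
  exact h' (HasRegSeq.mono hl hlt)

end Squarefree

theorem depth_principal {K : Type*} [Field K] {n d : ℕ} (f : Fin n →₀ ℕ)
    (hfsq : IsSqfree f) (hfd : mdeg f = d)
    (I J : Ideal (MvPolynomial (Fin n) K))
    (hIf : I = Ideal.span {monomial f (1 : K)}) (hJI : J < I)
    (hJ : GenSqfreeGe K (d + 1) J)
    (hrho : rho K I J (d + 2) + 1 < rho K I J (d + 1)) :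
    mdepth K n (quotMod I J) = d + 1 := by
  classical
  obtain ⟨G, hG, hJG⟩ := hJ
  have hfG : ∀ s ∈ G, f ≤ s := fun s hs => by
    rw [← mem_span_monomial_singleton_iff (K := K), ← hIf]
    exact hJI.le (hJG ▸ Ideal.subset_span ⟨s, hs, rfl⟩)
  have hrho' := hrho
  rw [hIf, hJG] at hrho'
  obtain ⟨W, ⟨u, huW, hfu, hu⟩, ⟨v, hvW, hfv, hv⟩, hW⟩ := exists_disconnection hfsq hfd hrho'
  set G' : Set (Fin n →₀ ℕ) := (· - f) '' G
  have hG'sq : ∀ s ∈ G', ∀ j, s j ≤ 1 := by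
    rintro _ ⟨s, hs, rfl⟩ j
    exact (Nat.sub_le _ _).trans ((hG s hs).1 j)
  have hG'f : ∀ s ∈ G', ∀ i ∈ f.support, s i = 0 := by
    rintro _ ⟨s, hs, rfl⟩ i hi
    have h1 := (hG s hs).1 i
    have h2 := Finsupp.mem_support_iff.mp hi
    simp only [Finsupp.tsub_apply]
    omega
  have hG'0 : 0 ∉ G' := fun h => hu (monomial_mem_monomialIdeal.mpr ⟨0, h, zero_le⟩)
  have hcard : f.support.card = d := by
    rw [← hfd, mdeg, Finsupp.sum, Finset.card_eq_sum_ones]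
    refine Finset.sum_congr rfl fun i hi => ?_
    have h1 := hfsq i
    have h2 := Finsupp.mem_support_iff.mp hi
    omega
  have hiff (k : ℕ) := hasRegSeq_union_single_iff (K := K) hG'sq hG'0 f.support hG'f k
  rw [hcard] at hiff
  set H : Set (Fin n →₀ ℕ) := G' ∪ (Finsupp.single · 1) '' (f.support : Set (Fin n))
  have hHX {i : Fin n} (hi : f i = 0) (hiG : (X i : MvPolynomial (Fin n) K) ∉ monomialIdeal K G') :
      (X i : MvPolynomial (Fin n) K) ∉ monomialIdeal K H := by
    rwa [X_mem_monomialIdeal_union_single (by simpa using hi)]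
  have hHf {i : Fin n} (hi : f i ≠ 0) : (X i : MvPolynomial (Fin n) K) ∈ monomialIdeal K H :=
    Ideal.subset_span ⟨_, Or.inr ⟨i, by simpa using hi, rfl⟩, rfl⟩
  have hHsq : ∀ s ∈ H, ∀ j, s j ≤ 1 := by
    rintro s (hs | ⟨i, -, rfl⟩) j
    · exact hG'sq s hs j
    · simp only [Finsupp.single_apply]
      split_ifs <;> simp
  have hH0 : 0 ∉ H := fun h =>
    hHX hfu hu (monomial_mem_monomialIdeal.mpr ⟨0, h, zero_le⟩)
  refine mdepth_eq_of_hasRegSeq ?_ ?_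
  · rw [← HasRegSeq.congr (quotModEquiv f G I J hIf hJG), add_comm, ← hiff 1,
      ← zero_add 1, ← hasRegSeq_quotient_sup_span_iff
        (sum_mem fun i _ => Ideal.subset_span (Set.mem_range_self i))
        (monomialIdeal_le_variableIdeal hH0) variableIdeal_ne_top
        (isSMulRegular_sum_X hHsq (hHX hfu hu))]
    have : Nontrivial (MvPolynomial (Fin n) K ⧸ (monomialIdeal K H ⊔
        Ideal.span {∑ i, (X i : MvPolynomial (Fin n) K)})) := by
      refine Ideal.Quotient.nontrivial_iff.mpr (ne_top_of_le_ne_top variableIdeal_ne_top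
        (sup_le (monomialIdeal_le_variableIdeal hH0) ?_))
      rw [Ideal.span_singleton_le_iff_mem]
      exact sum_mem fun i _ => Ideal.subset_span (Set.mem_range_self i)
    exact ⟨[], rfl, by simp, .nil _ _⟩
  · rw [← HasRegSeq.congr (quotModEquiv f G I J hIf hJG), add_assoc, add_comm, ← hiff]
    refine not_hasRegSeq_two (𝔟 := Ideal.span (X '' W)) (𝔠 := Ideal.span (X '' Wᶜ))
      variableIdeal_ne_top ?_ ?_ (Ideal.subset_span ⟨u, huW, rfl⟩)
      (Ideal.subset_span ⟨v, hvW, rfl⟩)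
      (fun g => mem_variableIdeal_of_X_mul_mem (hHX hfu hu))
      (fun g => mem_variableIdeal_of_X_mul_mem (hHX hfv hv))
    · rw [← Ideal.span_union, ← Set.image_union, Set.union_compl_self, Set.image_univ]
    · rw [Ideal.span_mul_span', Ideal.span_le]
      rintro _ ⟨_, ⟨i, hi, rfl⟩, _, ⟨j, hj, rfl⟩, rfl⟩
      by_cases hfi : f i = 0
      · by_cases hfj : f j = 0
        · exact Ideal.span_mono (Set.image_mono Set.subset_union_left) (hW i hi j hj hfi hfj)
        · exact Ideal.mul_mem_left _ _ (hHf hfj)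
      · exact Ideal.mul_mem_right _ _ (hHf hfi)
end

section
/- The quotient ring K[x_1,...,x_{d+s}]/L, where L is generated by all square-free monomials of degree 2 in the variables x_{d+1},...,x_{d+s}, has depth d+1. -/
open MvPolynomial

/-- The squarefree Veronese ideal generated by all squarefree degree-2 monomials
in the variables `x_{d+1}, …, x_{d+s}`. -/
noncomputable def veroneseL (K : Type*) [Field K] (d s : ℕ) :
    Ideal (MvPolynomial (Fin (d + s)) K) :=
  Ideal.span {p | ∃ j k : Fin (d + s), j ≠ k ∧ d ≤ (j : ℕ) ∧ d ≤ (k : ℕ) ∧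
    p = X j * X k}

open RingTheory.Sequence in
/-- The length of a regular sequence is bounded by the dimension of the support. -/
lemma length_le_supportDim_of_isRegular {R : Type*} [CommRing R]
    (rs : List R) {M : Type*} [AddCommGroup M] [Module R M] [Module.Finite R M]
    (reg : IsRegular M rs) : (rs.length : WithBot ℕ∞) ≤ Module.supportDim R M := by
  induction rs generalizing M with
  | nil =>
    have : Nontrivial M := by
      by_contra h
      rw [not_nontrivial_iff_subsingleton] at h
      exact reg.top_ne_smul (Subsingleton.elim _ _)
    have := (Module.supportDim_ne_bot_iff_nontrivial R M).mpr this
    obtain ⟨n, hn⟩ := WithBot.ne_bot_iff_exists.mp this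
    rw [← hn]
    exact WithBot.coe_le_coe.mpr zero_le
  | cons r rs ih =>
    obtain ⟨h₁, h₂⟩ := (isRegular_cons_iff M r rs).mp reg
    refine le_trans ?_ (Module.supportDim_quotSMulTop_succ_le_of_notMem_minimalPrimes
      fun _ ↦ h₁.notMem_of_mem_minimalPrimes)
    push_cast [List.length_cons]
    gcongr
    exact ih h₂

lemma ringKrullDim_le_of_isIntegral (A B : Type*) [CommRing A] [CommRing B] [Algebra A B]
    [Algebra.IsIntegral A B] : ringKrullDim B ≤ ringKrullDim A :=
  Order.krullDim_le_of_strictMono (PrimeSpectrum.comap (algebraMap A B))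
    fun _ _ h ↦ Ideal.IsIntegral.comap_lt_comap h

/-- The sum of the last `s` variables. -/
noncomputable def lastSum (K : Type*) [Field K] (d s : ℕ) : MvPolynomial (Fin (d + s)) K :=
  ∑ l : Fin s, X (Fin.natAdd d l)

lemma X_natAdd_mul_sub_lastSum_mem (K : Type*) [Field K] (d s : ℕ) (j : Fin s) :
    X (Fin.natAdd d j) * (X (Fin.natAdd d j) - lastSum K d s) ∈ veroneseL K d s := by
  have h : X (Fin.natAdd d j) - lastSum K d s =
      - ∑ l ∈ Finset.univ.erase j, X (Fin.natAdd d l) := by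
    rw [lastSum, ← Finset.add_sum_erase _ _ (Finset.mem_univ j)]
    ring
  rw [h, mul_neg, neg_mem_iff, Finset.mul_sum]
  refine sum_mem fun l hl ↦ Ideal.subset_span ⟨_, _, ?_, ?_, ?_, rfl⟩
  · simpa using (Finset.ne_of_mem_erase hl).symm
  · simp
  · simp

/-- The map from a polynomial ring in `d + 1` variables sending the variables to the classes of
`x_1, …, x_d` and of the sum of the last `s` variables. -/
noncomputable def noetherMap (K : Type*) [Field K] (d s : ℕ) :
    MvPolynomial (Option (Fin d)) K →ₐ[K] MvPolynomial (Fin (d + s)) K ⧸ veroneseL K d s :=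
  aeval fun o ↦ Ideal.Quotient.mk _ (o.elim (lastSum K d s) fun i ↦ X (Fin.castAdd s i))

lemma noetherMap_isIntegral (K : Type*) [Field K] (d s : ℕ) :
    (noetherMap K d s).toRingHom.IsIntegral := by
  intro x
  obtain ⟨p, rfl⟩ := Ideal.Quotient.mk_surjective x
  induction p using MvPolynomial.induction_on with
  | C a =>
    have := (noetherMap K d s).toRingHom.isIntegralElem_map (x := C a)
    simpa [noetherMap] using! this
  | add p q hp hq => rw [map_add]; exact hp.add _ hq
  | mul_X p i hp =>
    rw [map_mul]
    refine hp.mul _ ?_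
    induction i using Fin.addCases with
    | left i =>
      have := (noetherMap K d s).toRingHom.isIntegralElem_map (x := X (some i))
      simpa [noetherMap] using! this
    | right j =>
      refine ⟨Polynomial.X * (Polynomial.X - Polynomial.C (X none)),
        Polynomial.monic_X.mul (Polynomial.monic_X_sub_C _), ?_⟩
      have := Ideal.Quotient.eq_zero_iff_mem.mpr (X_natAdd_mul_sub_lastSum_mem K d s j)
      simpa [Polynomial.eval₂_mul, Polynomial.eval₂_sub, noetherMap] using! this

lemma ringKrullDim_quotient_veroneseL_le (K : Type*) [Field K] (d s : ℕ) :
    ringKrullDim (MvPolynomial (Fin (d + s)) K ⧸ veroneseL K d s) ≤ (d + 1 : ℕ) := by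
  let _ := (noetherMap K d s).toRingHom.toAlgebra
  have : Algebra.IsIntegral (MvPolynomial (Option (Fin d)) K)
      (MvPolynomial (Fin (d + s)) K ⧸ veroneseL K d s) := ⟨noetherMap_isIntegral K d s⟩
  refine (ringKrullDim_le_of_isIntegral (MvPolynomial (Option (Fin d)) K) _).trans ?_
  simp

section RegularSequence

lemma mk_mem_smul_top_iff {R : Type*} [CommRing R] (L I : Ideal R) (p : R) :
    (Submodule.Quotient.mk p : R ⧸ L) ∈ (I • ⊤ : Submodule R (R ⧸ L)) ↔ p ∈ L ⊔ I := by
  have h : (I • ⊤ : Submodule R (R ⧸ L)) = Submodule.map L.mkQ I := by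
    rw [← Submodule.range_mkQ, ← Submodule.map_top, ← Submodule.map_smul'']
    simp
  rw [h, ← Submodule.mkQ_apply, ← Submodule.mem_comap, Submodule.comap_map_mkQ]

lemma isSMulRegular_quotient_smul_top_iff {R : Type*} [CommRing R] (L I : Ideal R) (r : R) :
    IsSMulRegular ((R ⧸ L) ⧸ (I • ⊤ : Submodule R (R ⧸ L))) r ↔
      ∀ p, r * p ∈ L ⊔ I → p ∈ L ⊔ I := by
  rw [isSMulRegular_quotient_iff_mem_of_smul_mem, L.mkQ_surjective.forall]
  simp_rw [← map_smul, Submodule.mkQ_apply, mk_mem_smul_top_iff, smul_eq_mul]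

variable {K : Type*} [Field K] {d s : ℕ}

/-- The exponent vectors of the monomials in the ideal generated by `veroneseL K d s` and the
variables in `vs`. -/
def IsBadExponent (d : ℕ) {n : ℕ} (vs : List (Fin n)) (m : Fin n →₀ ℕ) : Prop :=
  (∃ v ∈ vs, m v ≠ 0) ∨ ∃ j k : Fin n, j ≠ k ∧ d ≤ (j : ℕ) ∧ d ≤ (k : ℕ) ∧ m j ≠ 0 ∧ m k ≠ 0

lemma mem_veroneseL_sup_iff (vs : List (Fin (d + s))) (p : MvPolynomial (Fin (d + s)) K) :
    p ∈ veroneseL K d s ⊔ Ideal.ofList (vs.map X) ↔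
      ∀ m ∈ p.support, IsBadExponent d vs m := by
  have h : veroneseL K d s ⊔ Ideal.ofList (vs.map X) =
      Ideal.span ((fun m ↦ monomial m (1 : K)) ''
        ({m | ∃ j k : Fin (d + s), j ≠ k ∧ d ≤ (j : ℕ) ∧ d ≤ (k : ℕ) ∧
          m = Finsupp.single j 1 + Finsupp.single k 1} ∪
        {m | ∃ v ∈ vs, m = Finsupp.single v 1})) := by
    rw [veroneseL, Ideal.ofList, ← Ideal.span_union, Set.image_union]
    congr 2
    · ext q
      constructor
      · rintro ⟨j, k, h₁, h₂, h₃, rfl⟩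
        exact ⟨_, ⟨j, k, h₁, h₂, h₃, rfl⟩, by simp [X, monomial_mul]⟩
      · rintro ⟨_, ⟨j, k, h₁, h₂, h₃, rfl⟩, rfl⟩
        exact ⟨j, k, h₁, h₂, h₃, by simp [X, monomial_mul]⟩
    · ext q
      constructor
      · intro hq
        obtain ⟨v, hv, rfl⟩ := List.mem_map.mp hq
        exact ⟨_, ⟨v, hv, rfl⟩, rfl⟩
      · rintro ⟨_, ⟨v, hv, rfl⟩, rfl⟩
        exact List.mem_map.mpr ⟨v, hv, rfl⟩
  rw [h, mem_ideal_span_monomial_image]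
  refine forall₂_congr fun m _ ↦ ⟨?_, ?_⟩
  · rintro ⟨_, ⟨j, k, h₁, h₂, h₃, rfl⟩ | ⟨v, hv, rfl⟩, hle⟩
    · refine .inr ⟨j, k, h₁, h₂, h₃, ?_, ?_⟩
      · have := hle j; simp at this; omega
      · have := hle k; simp at this; omega
    · exact .inl ⟨v, hv, by have := hle v; simp at this; omega⟩
  · rintro (⟨v, hv, h⟩ | ⟨j, k, h₁, h₂, h₃, h₄, h₅⟩)
    · exact ⟨_, .inr ⟨v, hv, rfl⟩, Finsupp.single_le_iff.mpr (Nat.one_le_iff_ne_zero.mpr h)⟩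
    · refine ⟨_, .inl ⟨j, k, h₁, h₂, h₃, rfl⟩, fun i ↦ ?_⟩
      simp only [Finsupp.add_apply, Finsupp.single_apply]
      grind

lemma mem_of_X_mul_mem {vs : List (Fin (d + s))} {v : Fin (d + s)} (hv : (v : ℕ) < d)
    (hvs : v ∉ vs) {p : MvPolynomial (Fin (d + s)) K}
    (h : X v * p ∈ veroneseL K d s ⊔ Ideal.ofList (vs.map X)) :
    p ∈ veroneseL K d s ⊔ Ideal.ofList (vs.map X) := by
  rw [mem_veroneseL_sup_iff] at h ⊢
  intro m hm
  have := h (Finsupp.single v 1 + m) (by simpa [mem_support_iff, coeff_X_mul] using hm)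
  have key (i : Fin (d + s)) (hi : i ≠ v) : (Finsupp.single v 1 + m : Fin (d + s) →₀ ℕ) i = m i := by
    simp [hi.symm]
  rcases this with ⟨w, hw, h₁⟩ | ⟨j, k, h₁, h₂, h₃, h₄, h₅⟩
  · exact .inl ⟨w, hw, by rwa [key w (by grind)] at h₁⟩
  · exact .inr ⟨j, k, h₁, h₂, h₃, by rwa [key j (by grind)] at h₄, by rwa [key k (by grind)] at h₅⟩

lemma mem_of_lastSum_mul_mem (hs : 1 ≤ s) {vs : List (Fin (d + s))}
    (hvs : ∀ v, v ∈ vs ↔ (v : ℕ) < d) {p : MvPolynomial (Fin (d + s)) K}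
    (h : lastSum K d s * p ∈ veroneseL K d s ⊔ Ideal.ofList (vs.map X)) :
    p ∈ veroneseL K d s ⊔ Ideal.ofList (vs.map X) := by
  classical
  rw [mem_veroneseL_sup_iff] at h ⊢
  intro m hm
  by_contra hbad
  simp only [IsBadExponent, not_or, not_exists, not_and, hvs, not_not] at hbad
  obtain ⟨hfirst, hlast⟩ := hbad
  obtain ⟨j, hj⟩ : ∃ j : Fin s, ∀ k, k ≠ Fin.natAdd d j → m k = 0 := by
    by_cases h0 : ∃ j : Fin s, m (Fin.natAdd d j) ≠ 0
    · obtain ⟨j, hj⟩ := h0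
      refine ⟨j, fun k hk ↦ ?_⟩
      by_cases hkd : (k : ℕ) < d
      · exact hfirst k hkd
      · exact hlast _ k hk.symm (by simp) (by omega) hj
    · push Not at h0
      refine ⟨⟨0, hs⟩, fun k _ ↦ ?_⟩
      induction k using Fin.addCases with
      | left i => exact hfirst _ (by simp)
      | right i => exact h0 i
  have hzero (k) (hk : k ≠ Fin.natAdd d j) :
      (Finsupp.single (Fin.natAdd d j) 1 + m : Fin (d + s) →₀ ℕ) k = 0 := by
    simp [hj k hk, hk.symm]
  have hcoeff : coeff (Finsupp.single (Fin.natAdd d j) 1 + m) (lastSum K d s * p) = coeff m p := by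
    rw [lastSum, Finset.sum_mul, coeff_sum, Finset.sum_eq_single j, coeff_X_mul]
    · intro l _ hl
      rw [coeff_X_mul', if_neg]
      simpa using hzero (Fin.natAdd d l) (by simpa using hl)
    · simp
  rcases h (Finsupp.single (Fin.natAdd d j) 1 + m)
      (by rw [mem_support_iff, hcoeff]; exact mem_support_iff.mp hm) with
    ⟨v, hv, h₁⟩ | ⟨k, l, h₁, h₂, h₃, h₄, h₅⟩
  · refine h₁ (hzero v ?_)
    rintro rfl
    simp [hvs] at hv
  · by_cases hk : k = Fin.natAdd d j
    · exact h₅ (hzero l (hk ▸ h₁.symm))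
    · exact h₄ (hzero k hk)

/-- The first `d` indices of `Fin (d + s)`. -/
def firstIndices (d s : ℕ) : List (Fin (d + s)) := (List.finRange d).map (Fin.castAdd s)

lemma mem_firstIndices {v : Fin (d + s)} : v ∈ firstIndices d s ↔ (v : ℕ) < d := by
  simp only [firstIndices, List.mem_map, List.mem_finRange, true_and]
  exact ⟨by rintro ⟨i, rfl⟩; simp, fun h ↦ ⟨⟨v, h⟩, rfl⟩⟩

lemma nodup_firstIndices (d s : ℕ) : (firstIndices d s).Nodup :=
  (List.nodup_finRange d).map (Fin.castAdd_injective d s)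

/-- The sequence `x_1, …, x_d, x_{d+1} + ⋯ + x_{d+s}`. -/
noncomputable def veroneseSeq (K : Type*) [Field K] (d s : ℕ) :
    List (MvPolynomial (Fin (d + s)) K) :=
  (firstIndices d s).map X ++ [lastSum K d s]

lemma mem_span_X_of_mem_veroneseSeq {r : MvPolynomial (Fin (d + s)) K}
    (hr : r ∈ veroneseSeq K d s) :
    r ∈ Ideal.span (Set.range (X : Fin (d + s) → MvPolynomial (Fin (d + s)) K)) := by
  rw [veroneseSeq, List.mem_append, List.mem_map, List.mem_singleton] at hr
  rcases hr with ⟨v, -, rfl⟩ | rfl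
  · exact Ideal.subset_span ⟨v, rfl⟩
  · exact sum_mem fun l _ ↦ Ideal.subset_span ⟨_, rfl⟩

lemma isRegular_veroneseSeq (hs : 1 ≤ s) :
    RingTheory.Sequence.IsRegular (MvPolynomial (Fin (d + s)) K ⧸ veroneseL K d s)
      (veroneseSeq K d s) where
  toIsWeaklyRegular := by
    rw [veroneseSeq, RingTheory.Sequence.isWeaklyRegular_append_iff,
      RingTheory.Sequence.isWeaklyRegular_singleton_iff, isSMulRegular_quotient_smul_top_iff]
    refine ⟨⟨fun i hi ↦ ?_⟩, fun p hp ↦ mem_of_lastSum_mul_mem hs (fun _ ↦ mem_firstIndices) hp⟩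
    rw [isSMulRegular_quotient_smul_top_iff, ← List.map_take, List.getElem_map]
    rw [List.length_map] at hi
    refine fun p hp ↦ mem_of_X_mul_mem (mem_firstIndices.mp (List.getElem_mem hi)) ?_ hp
    rw [List.mem_take_iff_getElem]
    rintro ⟨j, hj, h⟩
    have := (nodup_firstIndices d s).getElem_inj_iff.mp h
    omega
  top_ne_smul h := by
    have h1 : (1 : MvPolynomial (Fin (d + s)) K) ∈
        veroneseL K d s ⊔ Ideal.ofList (veroneseSeq K d s) := by
      rw [← mk_mem_smul_top_iff, ← h]
      trivial
    have hle : veroneseL K d s ⊔ Ideal.ofList (veroneseSeq K d s) ≤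
        RingHom.ker (constantCoeff (R := K)) := by
      refine sup_le (Ideal.span_le.mpr ?_) (Ideal.span_le.mpr fun r hr ↦ ?_)
      · rintro _ ⟨j, k, -, -, -, rfl⟩
        simp
      · refine Ideal.span_le.mpr ?_ (mem_span_X_of_mem_veroneseSeq hr)
        rintro _ ⟨v, rfl⟩
        simp
    simpa using RingHom.mem_ker.mp (hle h1)

end RegularSequence

theorem depth_veronese {K : Type*} [Field K] {d s : ℕ} (hd : 1 ≤ d) (hs : 1 ≤ s) :
    mdepth K (d + s) (MvPolynomial (Fin (d + s)) K ⧸ veroneseL K d s) = d + 1 := by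
  refine IsGreatest.csSup_eq ⟨⟨veroneseSeq K d s, by simp [veroneseSeq, firstIndices],
    fun _ ↦ mem_span_X_of_mem_veroneseSeq, isRegular_veroneseSeq hs⟩, ?_⟩
  rintro _ ⟨rs, rfl, -, hreg⟩
  have h := (length_le_supportDim_of_isRegular rs hreg).trans
    ((Module.supportDim_quotient_eq_ringKrullDim _).trans_le
      (ringKrullDim_quotient_veroneseL_le K d s))
  exact_mod_cast h
end
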